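/- arXiv:1902.00444 — 7 statements merged into one kernel-verified Lean document; each statement's English description precedes it below -/
import Mathlib

section
/- Let E(λ)=A+λB be an n×n Hermitian matrix pencil over ℂ (i.e., A=A^*, B=B^*) whose rank equals r (r ≤ n). Then there exist nonnegative integers ℓ, s with ℓ+2s=r, real numbers a_1,…,a_ℓ, b_1,…,b_ℓ, vectors u_1,…,u_ℓ, v_1,…,v_s ∈ ℂ^n, and vector pencils w_1,…,w_s of degree at most one (w_j(λ)=c_j+λd_j with c_j,d_j∈ℂ^n) such that A+λB = Σ_{i=1}^{ℓ} (a_i+λb_i) u_i u_i^* + Σ_{j=1}^{s} ( v_j w_j(λ)^* + w_j(λ) v_j^* ). -/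
open Matrix BigOperators

/-- The rank of the pencil `A + λ B` (the maximum over `μ ∈ ℂ` of the rank of
`A + μ B`) equals `r`. -/
def PencilRankEq (n : ℕ) (A B : Matrix (Fin n) (Fin n) ℂ) (r : ℕ) : Prop :=
  (∃ μ : ℂ, (A + μ • B).rank = r) ∧ ∀ μ : ℂ, (A + μ • B).rank ≤ r

section HermitianPencil

open scoped ComplexOrder

variable {n : ℕ}

/-- The pencil `A + λ B` is a sum of `ℓ` real multiples of Hermitian dyads and `s` Hermitian
pairs of dyads, with `ℓ + 2 * s = r`. -/
def HasDyadDecomposition (A B : Matrix (Fin n) (Fin n) ℂ) (r : ℕ) : Prop :=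
  ∃ (ℓ s : ℕ), ℓ + 2 * s = r ∧
    ∃ (a b : Fin ℓ → ℝ) (u : Fin ℓ → Fin n → ℂ) (v c d : Fin s → Fin n → ℂ),
      ∀ lam : ℂ,
        A + lam • B =
          (∑ i : Fin ℓ, ((a i : ℂ) + lam * (b i : ℂ)) • vecMulVec (u i) (star (u i)))
          + ∑ j : Fin s,
              (vecMulVec (v j) (star (c j) + lam • star (d j))
                + vecMulVec (c j + lam • d j) (star (v j)))

theorem HasDyadDecomposition.zero (r : ℕ) :
    HasDyadDecomposition (0 : Matrix (Fin n) (Fin n) ℂ) 0 r :=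
  ⟨r, 0, by simp, 0, 0, 0, 0, 0, 0, by simp⟩

theorem HasDyadDecomposition.of_sub_dyad {A B : Matrix (Fin n) (Fin n) ℂ} {r : ℕ}
    (α β : ℝ) (f : Fin n → ℂ)
    (h : HasDyadDecomposition (A - (α : ℂ) • vecMulVec f (star f))
      (B - (β : ℂ) • vecMulVec f (star f)) r) :
    HasDyadDecomposition A B (r + 1) := by
  obtain ⟨ℓ, s, hls, a, b, u, v, c, d, h⟩ := h
  refine ⟨ℓ + 1, s, by omega, Fin.cons α a, Fin.cons β b, Fin.cons f u, v, c, d, fun lam => ?_⟩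
  simp only [Fin.sum_univ_succ, Fin.cons_zero, Fin.cons_succ]
  rw [add_assoc, ← h lam]
  module

theorem HasDyadDecomposition.of_sub_dyad_pair {A B : Matrix (Fin n) (Fin n) ℂ} {r : ℕ}
    (f g k : Fin n → ℂ)
    (h : HasDyadDecomposition (A - (vecMulVec f (star g) + vecMulVec g (star f)))
      (B - (vecMulVec f (star k) + vecMulVec k (star f))) r) :
    HasDyadDecomposition A B (r + 2) := by
  obtain ⟨ℓ, s, hls, a, b, u, v, c, d, h⟩ := h
  refine ⟨ℓ, s + 1, by omega, a, b, u, Fin.cons f v, Fin.cons g c, Fin.cons k d, fun lam => ?_⟩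
  simp only [Fin.sum_univ_succ, Fin.cons_zero, Fin.cons_succ]
  rw [add_left_comm, ← h lam]
  simp only [vecMulVec_add, add_vecMulVec, vecMulVec_smul, smul_vecMulVec]
  module

theorem vecMulVec_mulVec_eq_smul (u f z : Fin n → ℂ) :
    vecMulVec u f *ᵥ z = (f ⬝ᵥ z) • u := by
  rw [vecMulVec_mulVec, op_smul_eq_smul]

theorem Matrix.IsHermitian.star_dotProduct_mulVec {A : Matrix (Fin n) (Fin n) ℂ}
    (hA : A.IsHermitian) (x z : Fin n → ℂ) :
    star x ⬝ᵥ A *ᵥ z = star (A *ᵥ x) ⬝ᵥ z := by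
  rw [star_mulVec, hA.eq, dotProduct_mulVec]

theorem Matrix.IsHermitian.star_dotProduct_mulVec_self {A : Matrix (Fin n) (Fin n) ℂ}
    (hA : A.IsHermitian) (y : Fin n → ℂ) :
    star (star y ⬝ᵥ A *ᵥ y) = star y ⬝ᵥ A *ᵥ y := by
  rw [← star_dotProduct, hA.star_dotProduct_mulVec]

/-- A nonzero Hermitian pencil has a direction `x` whose image is a nonzero scalar pencil times a
fixed nonzero vector. -/
theorem exists_mulVec_eq_smul_of_isHermitian {A B : Matrix (Fin n) (Fin n) ℂ}
    (hA : A.IsHermitian) (hB : B.IsHermitian) (h0 : ¬(A = 0 ∧ B = 0)) :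
    ∃ (x f : Fin n → ℂ) (p q : ℂ), f ≠ 0 ∧ (p ≠ 0 ∨ q ≠ 0) ∧
      A *ᵥ x = p • f ∧ B *ᵥ x = q • f := by
  let W : Submodule ℂ (Fin n → ℂ) := LinearMap.range A.mulVecLin ⊔ LinearMap.range B.mulVecLin
  have hAW : ∀ z, A *ᵥ z ∈ W := fun z => Submodule.mem_sup_left ⟨z, rfl⟩
  have hBW : ∀ z, B *ᵥ z ∈ W := fun z => Submodule.mem_sup_right ⟨z, rfl⟩
  have hker : ∀ w ∈ W, A *ᵥ w = 0 → B *ᵥ w = 0 → w = 0 := by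
    intro w hw h1 h2
    obtain ⟨_, ⟨y, rfl⟩, _, ⟨z, rfl⟩, hyz⟩ := Submodule.mem_sup.mp hw
    rw [← dotProduct_star_self_eq_zero]
    nth_rewrite 2 [← hyz]
    simp only [mulVecLin_apply, dotProduct_add, hA.star_dotProduct_mulVec,
      hB.star_dotProduct_mulVec, h1, h2]
    simp
  have : Nontrivial W := by
    rw [Submodule.nontrivial_iff_ne_bot]
    intro hbot
    have hzero : ∀ C : Matrix (Fin n) (Fin n) ℂ, (∀ z, C *ᵥ z ∈ W) → C = 0 := fun C hC =>
      ext_of_mulVec_single fun i => by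
        rw [zero_mulVec, (Submodule.eq_bot_iff W).mp hbot _ (hC _)]
    exact h0 ⟨hzero A hAW, hzero B hBW⟩
  let a : Module.End ℂ W := A.mulVecLin.restrict (p := W) (q := W) fun z _ => hAW z
  let b : Module.End ℂ W := B.mulVecLin.restrict (p := W) (q := W) fun z _ => hBW z
  by_cases hb : Function.Injective b
  · let e := LinearEquiv.ofInjectiveEndo b hb
    obtain ⟨τ, hτ⟩ := Module.End.exists_eigenvalue (e.symm.toLinearMap ∘ₗ a)
    obtain ⟨w, hw⟩ := hτ.exists_hasEigenvector
    have h1 : a w = τ • b w := by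
      have := congrArg e hw.apply_eq_smul
      simpa [e] using this
    have h2 : A *ᵥ (w : Fin n → ℂ) = τ • B *ᵥ (w : Fin n → ℂ) := congrArg Subtype.val h1
    refine ⟨w, B *ᵥ (w : Fin n → ℂ), τ, 1, fun hB0 => hw.2 ?_, by simp, h2, by simp⟩
    exact Subtype.ext (hker w w.2 (by simp [h2, hB0]) hB0)
  · rw [← LinearMap.ker_eq_bot, Submodule.eq_bot_iff] at hb
    push Not at hb
    obtain ⟨w, hw, hw0⟩ := hb
    have h2 : B *ᵥ (w : Fin n → ℂ) = 0 := congrArg Subtype.val hw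
    refine ⟨w, A *ᵥ (w : Fin n → ℂ), 1, 0, fun hA0 => hw0 ?_, by simp, by simp, by simp [h2]⟩
    exact Subtype.ext (hker w w.2 hA0 h2)

theorem eventually_cofinite_add_mul_ne_zero {p q : ℂ} (h : p ≠ 0 ∨ q ≠ 0) :
    ∀ᶠ μ : ℂ in Filter.cofinite, p + μ * q ≠ 0 := by
  rw [Filter.eventually_cofinite]
  refine (Set.finite_singleton (-p / q)).subset fun μ hμ => ?_
  have hμ : p + μ * q = 0 := by simpa using hμ
  have hq : q ≠ 0 := by
    rintro rfl
    simp_all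
  rw [Set.mem_singleton_iff, eq_div_iff hq]
  linear_combination hμ

theorem rank_add_finrank_ker_mulVecLin (M : Matrix (Fin n) (Fin n) ℂ) :
    M.rank + Module.finrank ℂ (LinearMap.ker M.mulVecLin) = n := by
  simpa [Matrix.rank] using M.mulVecLin.finrank_range_add_finrank_ker

/-- Vectors annihilated by `A + μ B` are orthogonal to `f` when `(A + μ B) x` is a suitable
multiple of `f`. -/
theorem star_dotProduct_eq_zero_of_mulVec_eq_zero {A B : Matrix (Fin n) (Fin n) ℂ}
    (hA : A.IsHermitian) (hB : B.IsHermitian) {x f : Fin n → ℂ} {p q μ : ℂ}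
    (hAx : A *ᵥ x = p • f) (hBx : B *ᵥ x = q • f) (hμ : star p + μ * star q ≠ 0)
    {z : Fin n → ℂ} (hz : (A + μ • B) *ᵥ z = 0) : star f ⬝ᵥ z = 0 := by
  have h : star x ⬝ᵥ (A + μ • B) *ᵥ z = 0 := by rw [hz, dotProduct_zero]
  rw [add_mulVec, smul_mulVec, dotProduct_add, dotProduct_smul, hA.star_dotProduct_mulVec,
    hB.star_dotProduct_mulVec, hAx, hBx, star_smul, star_smul, smul_dotProduct, smul_dotProduct,
    smul_eq_mul, smul_eq_mul, smul_eq_mul, ← mul_assoc, ← add_mul] at h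
  exact (mul_eq_zero.mp h).resolve_left hμ

theorem rank_sub_dyad_lt {A B : Matrix (Fin n) (Fin n) ℂ}
    (hA : A.IsHermitian) (hB : B.IsHermitian) {x f : Fin n → ℂ} {α β : ℝ} {μ : ℂ}
    (hxf : star f ⬝ᵥ x = 1)
    (hAx : A *ᵥ x = (α : ℂ) • f) (hBx : B *ᵥ x = (β : ℂ) • f) (hμ : (α : ℂ) + μ * β ≠ 0) :
    ((A - (α : ℂ) • vecMulVec f (star f)) + μ • (B - (β : ℂ) • vecMulVec f (star f))).rank + 1
      ≤ (A + μ • B).rank := by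
  set M := A + μ • B with hM
  set M' := (A - (α : ℂ) • vecMulVec f (star f)) + μ • (B - (β : ℂ) • vecMulVec f (star f))
  have hM' : ∀ z, M' *ᵥ z = M *ᵥ z - (((α : ℂ) + μ * β) * (star f ⬝ᵥ z)) • f := by
    intro z
    simp only [M', M, add_mulVec, sub_mulVec, smul_mulVec, vecMulVec_mulVec_eq_smul]
    module
  have hMx : M *ᵥ x = ((α : ℂ) + μ * β) • f := by
    rw [hM, add_mulVec, smul_mulVec, hAx, hBx]
    module
  have hf : f ≠ 0 := by
    rintro rfl
    simp at hxf
  have hlt : LinearMap.ker M.mulVecLin < LinearMap.ker M'.mulVecLin := by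
    rw [SetLike.lt_iff_le_and_exists]
    refine ⟨fun z hz => ?_, x, ?_, ?_⟩
    · have hz : M *ᵥ z = 0 := hz
      have := star_dotProduct_eq_zero_of_mulVec_eq_zero hA hB hAx hBx (by simpa using hμ) hz
      simp [hM', hz, this]
    · simp [hM', hMx, hxf]
    · simp only [LinearMap.mem_ker, mulVecLin_apply, hMx]
      exact smul_ne_zero hμ hf
  have := Submodule.finrank_lt_finrank_of_lt hlt
  have := rank_add_finrank_ker_mulVecLin M
  have := rank_add_finrank_ker_mulVecLin M'
  omega

theorem rank_sub_dyad_pair_lt {A B : Matrix (Fin n) (Fin n) ℂ}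
    (hA : A.IsHermitian) (hB : B.IsHermitian) {x y f g k : Fin n → ℂ} {p q μ : ℂ}
    (hfx : star f ⬝ᵥ x = 0) (hfy : star f ⬝ᵥ y = 1)
    (hAx : A *ᵥ x = p • f) (hBx : B *ᵥ x = q • f)
    (hg : g = A *ᵥ y - ((1 / 2 : ℂ) * (star y ⬝ᵥ A *ᵥ y)) • f)
    (hk : k = B *ᵥ y - ((1 / 2 : ℂ) * (star y ⬝ᵥ B *ᵥ y)) • f)
    (hμ : p + μ * q ≠ 0) (hμ' : star p + μ * star q ≠ 0) :
    ((A - (vecMulVec f (star g) + vecMulVec g (star f)))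
      + μ • (B - (vecMulVec f (star k) + vecMulVec k (star f)))).rank + 2
      ≤ (A + μ • B).rank := by
  set M := A + μ • B with hM
  set M' := (A - (vecMulVec f (star g) + vecMulVec g (star f)))
      + μ • (B - (vecMulVec f (star k) + vecMulVec k (star f)))
  have hyf : star y ⬝ᵥ f = 1 := by
    rw [star_dotProduct, hfy, star_one]
  have hpair : ∀ {C : Matrix (Fin n) (Fin n) ℂ}, C.IsHermitian → ∀ z,
      star (C *ᵥ y - ((1 / 2 : ℂ) * (star y ⬝ᵥ C *ᵥ y)) • f) ⬝ᵥ z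
        = star y ⬝ᵥ C *ᵥ z - (1 / 2 : ℂ) * (star y ⬝ᵥ C *ᵥ y) * (star f ⬝ᵥ z) := by
    intro C hC z
    rw [star_sub, sub_dotProduct, ← hC.star_dotProduct_mulVec, star_smul, star_mul',
      hC.star_dotProduct_mulVec_self,
      smul_dotProduct, smul_eq_mul]
    simp
  have hM' : ∀ z, M' *ᵥ z = M *ᵥ z - (star y ⬝ᵥ M *ᵥ z) • f
      - (star f ⬝ᵥ z) • (M *ᵥ y - (star y ⬝ᵥ M *ᵥ y) • f) := by
    intro z
    simp only [M', M, add_mulVec, sub_mulVec, smul_mulVec, vecMulVec_mulVec_eq_smul,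
      dotProduct_add, dotProduct_smul]
    rw [hg, hk, hpair hA, hpair hB]
    module
  have hMx : M *ᵥ x = (p + μ * q) • f := by
    rw [hM, add_mulVec, smul_mulVec, hAx, hBx]
    module
  have hf : f ≠ 0 := by
    rintro rfl
    simp at hfy
  let L : Submodule ℂ (Fin n → ℂ) := LinearMap.ker (dotProductBilin ℂ ℂ (star f))
  have hL : ∀ z, z ∈ L ↔ star f ⬝ᵥ z = 0 := fun z => Iff.rfl
  have hlt : LinearMap.ker M.mulVecLin < LinearMap.ker M'.mulVecLin ⊓ L := by
    rw [SetLike.lt_iff_le_and_exists]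
    refine ⟨fun z hz => ?_, x, ⟨?_, hfx⟩, ?_⟩
    · have hz : M *ᵥ z = 0 := hz
      have := star_dotProduct_eq_zero_of_mulVec_eq_zero hA hB hAx hBx hμ' hz
      exact ⟨by simp [hM', hz, this], this⟩
    · simp [hM', hMx, hfx, hyf]
    · simp only [LinearMap.mem_ker, mulVecLin_apply, hMx]
      exact smul_ne_zero hμ hf
  have hlt' : LinearMap.ker M'.mulVecLin ⊓ L < LinearMap.ker M'.mulVecLin := by
    rw [SetLike.lt_iff_le_and_exists]
    refine ⟨inf_le_left, y, ?_, fun hy => ?_⟩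
    · simp [hM', hfy]
    · simpa [hfy] using (hL y).mp hy.2
  have := Submodule.finrank_lt_finrank_of_lt hlt
  have := Submodule.finrank_lt_finrank_of_lt hlt'
  have := rank_add_finrank_ker_mulVecLin M
  have := rank_add_finrank_ker_mulVecLin M'
  omega

theorem isHermitian_dyad_pair (f g : Fin n → ℂ) :
    (vecMulVec f (star g) + vecMulVec g (star f)).IsHermitian := by
  rw [IsHermitian, conjTranspose_add, conjTranspose_vecMulVec, conjTranspose_vecMulVec,
    star_star, star_star, add_comm]

theorem isHermitian_real_smul_dyad (α : ℝ) (f : Fin n → ℂ) :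
    ((α : ℂ) • vecMulVec f (star f)).IsHermitian := by
  rw [IsHermitian, conjTranspose_smul, conjTranspose_vecMulVec, star_star]
  simp

/-- Induction on `r`: a direction `x` mapped by the pencil to multiples of one vector `f` lets one
split off a dyad if `f` and `x` are not orthogonal, and a pair of dyads if they are. -/
theorem hasDyadDecomposition_of_eventually_rank_le (r : ℕ) :
    ∀ A B : Matrix (Fin n) (Fin n) ℂ, A.IsHermitian → B.IsHermitian →
      (∀ᶠ μ : ℂ in Filter.cofinite, (A + μ • B).rank ≤ r) → HasDyadDecomposition A B r := by
  induction r using Nat.strong_induction_on with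
  | _ r ih =>
  intro A B hA hB hr
  by_cases h0 : A = 0 ∧ B = 0
  · rw [h0.1, h0.2]
    exact .zero r
  obtain ⟨x, f, p, q, hf, hpq, hAx, hBx⟩ := exists_mulVec_eq_smul_of_isHermitian hA hB h0
  by_cases hfx : star f ⬝ᵥ x = 0
  · have hff : star f ⬝ᵥ f ≠ 0 := by
      rwa [ne_eq, dotProduct_star_self_eq_zero]
    let y := (star f ⬝ᵥ f)⁻¹ • f
    have hfy : star f ⬝ᵥ y = 1 := by
      rw [dotProduct_smul, smul_eq_mul, inv_mul_cancel₀ hff]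
    have hpq' : star p ≠ 0 ∨ star q ≠ 0 := by simpa using hpq
    have hrank := (hr.and ((eventually_cofinite_add_mul_ne_zero hpq).and
      (eventually_cofinite_add_mul_ne_zero hpq'))).mono fun μ hμ =>
        (rank_sub_dyad_pair_lt hA hB hfx hfy hAx hBx rfl rfl hμ.2.1 hμ.2.2).trans hμ.1
    obtain ⟨μ, hμ⟩ := hrank.exists
    obtain ⟨t, rfl⟩ : ∃ t, r = t + 2 := ⟨r - 2, by omega⟩
    exact .of_sub_dyad_pair f _ _ (ih t (by omega) _ _ (hA.sub (isHermitian_dyad_pair _ _))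
      (hB.sub (isHermitian_dyad_pair _ _))
      (hrank.mono fun μ hμ => Nat.le_of_add_le_add_right hμ))
  · have hxf : star x ⬝ᵥ f ≠ 0 := by
      rwa [star_dotProduct, star_ne_zero]
    let f' := (star x ⬝ᵥ f)⁻¹ • f
    have hxf' : star x ⬝ᵥ f' = 1 := by
      rw [dotProduct_smul, smul_eq_mul, inv_mul_cancel₀ hxf]
    have hfx' : star f' ⬝ᵥ x = 1 := by
      rw [star_dotProduct, hxf', star_one]
    have hreal : ∀ {C : Matrix (Fin n) (Fin n) ℂ} {t : ℂ}, C.IsHermitian → C *ᵥ x = t • f →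
        ∃ α : ℝ, (α : ℂ) = t * (star x ⬝ᵥ f) ∧ C *ᵥ x = (α : ℂ) • f' := by
      intro C t hC hCx
      obtain ⟨α, hα⟩ := Complex.conj_eq_iff_real.mp (hC.star_dotProduct_mulVec_self x)
      rw [hCx, dotProduct_smul, smul_eq_mul] at hα
      exact ⟨α, hα.symm, by rw [← hα, hCx, smul_smul, mul_assoc, mul_inv_cancel₀ hxf, mul_one]⟩
    obtain ⟨α, hα, hAx'⟩ := hreal hA hAx
    obtain ⟨β, hβ, hBx'⟩ := hreal hB hBx
    have hαβ : (α : ℂ) ≠ 0 ∨ (β : ℂ) ≠ 0 := by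
      rw [hα, hβ]
      exact hpq.imp (mul_ne_zero · hxf) (mul_ne_zero · hxf)
    have hrank := (hr.and (eventually_cofinite_add_mul_ne_zero hαβ)).mono fun μ hμ =>
      (rank_sub_dyad_lt hA hB hfx' hAx' hBx' hμ.2).trans hμ.1
    obtain ⟨μ, hμ⟩ := hrank.exists
    obtain ⟨t, rfl⟩ : ∃ t, r = t + 1 := ⟨r - 1, by omega⟩
    exact .of_sub_dyad α β f' (ih t (by omega) _ _ (hA.sub (isHermitian_real_smul_dyad _ _))
      (hB.sub (isHermitian_real_smul_dyad _ _))
      (hrank.mono fun μ hμ => Nat.le_of_add_le_add_right hμ))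

end HermitianPencil

/-- **Rank-1 decomposition for Hermitian pencils.**
If `E(λ) = A + λB` is an `n × n` Hermitian matrix pencil of rank `r ≤ n`, then there
exist `ℓ, s` with `ℓ + 2s = r`, real numbers `a_i, b_i`, vectors `u_i, v_j ∈ ℂ^n` and
vector pencils `w_j(λ) = c_j + λ d_j` of degree at most one such that
`A + λB = Σ (a_i + λ b_i) u_i u_i^* + Σ (v_j w_j(λ)^* + w_j(λ) v_j^*)`. -/
theorem hermitian_rank_one_decomposition
    (n r : ℕ) (hrn : r ≤ n) (A B : Matrix (Fin n) (Fin n) ℂ)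
    (hA : A.IsHermitian) (hB : B.IsHermitian)
    (hrank : PencilRankEq n A B r) :
    ∃ (ℓ s : ℕ), ℓ + 2 * s = r ∧
      ∃ (a b : Fin ℓ → ℝ) (u : Fin ℓ → Fin n → ℂ)
        (v c d : Fin s → Fin n → ℂ),
        ∀ lam : ℂ,
          A + lam • B =
            (∑ i : Fin ℓ, ((a i : ℂ) + lam * (b i : ℂ)) • vecMulVec (u i) (star (u i)))
            + ∑ j : Fin s,
                (vecMulVec (v j) (star (c j) + lam • star (d j))
                  + vecMulVec (c j + lam • d j) (star (v j))) := by
  exact hasDyadDecomposition_of_eventually_rank_le r A B hA hB (.of_forall hrank.2)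
end

section
/- Let E(λ)=A+λB be an n×n Hermitian matrix pencil over ℂ whose rank equals r, and suppose A+λB = Σ_{i=1}^{ℓ} (a_i+λb_i) u_i u_i^* + Σ_{j=1}^{s} ( v_j w_j(λ)^* + w_j(λ) v_j^* ), where ℓ+2s=r, a_i,b_i ∈ ℝ, u_i, v_j ∈ ℂ^n, and w_1,…,w_s are vector pencils of degree at most one. Then the vectors u_1,…,u_ℓ, v_1,…,v_s are linearly independent in ℂ^n. -/
open Matrix BigOperators

/-- If an `n × n` Hermitian matrix pencil `A + λB` of rank `r` admits a decomposition
`A + λB = Σ (a_i + λ b_i) u_i u_i^* + Σ (v_j w_j(λ)^* + w_j(λ) v_j^*)` with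
`ℓ + 2s = r`, `a_i, b_i ∈ ℝ`, then the vectors `u_1, …, u_ℓ, v_1, …, v_s` are
linearly independent in `ℂ^n`. -/
theorem hermitian_rank_one_decomposition_linearIndependent
    (n r ℓ s : ℕ) (hls : ℓ + 2 * s = r)
    (A B : Matrix (Fin n) (Fin n) ℂ)
    (hA : A.IsHermitian) (hB : B.IsHermitian)
    (hrank : PencilRankEq n A B r)
    (a b : Fin ℓ → ℝ) (u : Fin ℓ → Fin n → ℂ)
    (v c d : Fin s → Fin n → ℂ)
    (hdecomp : ∀ lam : ℂ,
      A + lam • B =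
        (∑ i : Fin ℓ, ((a i : ℂ) + lam * (b i : ℂ)) • vecMulVec (u i) (star (u i)))
        + ∑ j : Fin s,
            (vecMulVec (v j) (star (c j) + lam • star (d j))
              + vecMulVec (c j + lam • d j) (star (v j)))) :
    LinearIndependent ℂ (Sum.elim u v) := by
  obtain ⟨μ, hμ⟩ := hrank.1
  set f : (Fin ℓ ⊕ Fin s) ⊕ Fin s → Fin n → ℂ :=
    Sum.elim (Sum.elim u v) (fun j => c j + μ • d j)
  have hu (i : Fin ℓ) : u i ∈ Submodule.span ℂ (Set.range f) :=
    Submodule.subset_span ⟨.inl (.inl i), rfl⟩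
  have hv (j : Fin s) : v j ∈ Submodule.span ℂ (Set.range f) :=
    Submodule.subset_span ⟨.inl (.inr j), rfl⟩
  have hw (j : Fin s) : c j + μ • d j ∈ Submodule.span ℂ (Set.range f) :=
    Submodule.subset_span ⟨.inr j, rfl⟩
  have hrange : LinearMap.range (A + μ • B).mulVecLin ≤ Submodule.span ℂ (Set.range f) := by
    rintro _ ⟨x, rfl⟩
    rw [hdecomp μ, mulVecLin_apply, add_mulVec, sum_mulVec, sum_mulVec]
    refine add_mem (sum_mem fun i _ => ?_) (sum_mem fun j _ => ?_)
    · rw [smul_mulVec, vecMulVec_mulVec, op_smul_eq_smul]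
      exact Submodule.smul_mem _ _ (Submodule.smul_mem _ _ (hu i))
    · rw [add_mulVec, vecMulVec_mulVec, vecMulVec_mulVec, op_smul_eq_smul, op_smul_eq_smul]
      exact add_mem (Submodule.smul_mem _ _ (hv j)) (Submodule.smul_mem _ _ (hw j))
  have hli : LinearIndependent ℂ f := by
    rw [linearIndependent_iff_card_le_finrank_span]
    calc Fintype.card ((Fin ℓ ⊕ Fin s) ⊕ Fin s) = (A + μ • B).rank := by
          simp only [Fintype.card_sum, Fintype.card_fin]
          omega
      _ ≤ _ := Submodule.finrank_mono hrange
  exact hli.comp Sum.inl Sum.inl_injective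
end

section
/- Let E(λ)=A+λB be an n×n complex symmetric matrix pencil (i.e., A=A^T, B=B^T) whose rank equals r (r ≤ n). Then there exist nonnegative integers ℓ, s with ℓ+2s=r, complex numbers a_1,…,a_ℓ, b_1,…,b_ℓ, vectors u_1,…,u_ℓ, v_1,…,v_s ∈ ℂ^n, and vector pencils w_1,…,w_s of degree at most one such that A+λB = Σ_{i=1}^{ℓ} (a_i+λb_i) u_i u_i^T + Σ_{j=1}^{s} ( v_j w_j(λ)^T + w_j(λ) v_j^T ). -/
open Matrix BigOperators

open Filter

/-- A linear map that kills the kernel of `f` factors through `f`. -/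
theorem LinearMap.exists_comp_eq_of_ker_le {K V W U : Type*} [Field K] [AddCommGroup V] [Module K V]
    [AddCommGroup W] [Module K W] [AddCommGroup U] [Module K U] (f : V →ₗ[K] W) (g : V →ₗ[K] U)
    (h : LinearMap.ker f ≤ LinearMap.ker g) : ∃ k : W →ₗ[K] U, k ∘ₗ f = g := by
  obtain ⟨σ, hσ⟩ := f.rangeRestrict.exists_rightInverse_of_surjective f.range_rangeRestrict
  obtain ⟨k, hk⟩ := LinearMap.exists_extend (g ∘ₗ σ)
  refine ⟨k, LinearMap.ext fun x => ?_⟩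
  have h₁ : k (f x) = g (σ (f.rangeRestrict x)) := LinearMap.congr_fun hk (f.rangeRestrict x)
  have h₂ : f (σ (f.rangeRestrict x)) = f x :=
    congrArg Subtype.val (LinearMap.congr_fun hσ (f.rangeRestrict x))
  have h₃ : σ (f.rangeRestrict x) - x ∈ LinearMap.ker g := h (by simp [h₂])
  rw [LinearMap.comp_apply, h₁]
  simpa [sub_eq_zero] using h₃

namespace Matrix

variable {n : Type*} [Fintype n]

theorem rank_mul_lt_of_mulVec_eq_zero {K : Type*} [Field K] [DecidableEq n] (Q E : Matrix n n K)
    (x : n → K) (hx : E *ᵥ x ≠ 0) (hQ : Q *ᵥ (E *ᵥ x) = 0) : (Q * E).rank < E.rank := by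
  have hlt : LinearMap.ker E.mulVecLin < LinearMap.ker (Q * E).mulVecLin := by
    refine SetLike.lt_iff_le_and_exists.2 ⟨fun y hy => ?_, x, ?_, hx⟩
    · have hy : E *ᵥ y = 0 := hy
      simp [hy]
    · simpa [← mulVec_mulVec] using hQ
  have h₁ := Submodule.finrank_lt_finrank_of_lt hlt
  have h₂ := LinearMap.finrank_range_add_finrank_ker E.mulVecLin
  have h₃ := LinearMap.finrank_range_add_finrank_ker (Q * E).mulVecLin
  unfold rank
  omega

/-- A nonzero symmetric pencil has an eigenvector, possibly at infinity, outside its common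
kernel. -/
theorem exists_mulVec_eq_smul_of_isSymm {K : Type*} [Field K] [IsAlgClosed K] [DecidableEq n]
    {A B : Matrix n n K} (hA : A.IsSymm) (hB : B.IsSymm) (h : A ≠ 0 ∨ B ≠ 0) :
    ∃ (x v : n → K) (p q : K), v ≠ 0 ∧ (p ≠ 0 ∨ q ≠ 0) ∧ A *ᵥ x = p • v ∧ B *ᵥ x = q • v := by
  by_cases hker : LinearMap.ker A.mulVecLin ≤ LinearMap.ker B.mulVecLin
  · obtain ⟨k, hk⟩ := LinearMap.exists_comp_eq_of_ker_le _ _ hker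
    have hkA : ∀ x, k (A *ᵥ x) = B *ᵥ x := fun x => LinearMap.congr_fun hk x
    have hBA : B = LinearMap.toMatrix' k * A :=
      Matrix.ext_of_mulVec_single fun i => by
        rw [← mulVec_mulVec, LinearMap.toMatrix'_mulVec, hkA]
    have hBA' : B = A * (LinearMap.toMatrix' k)ᵀ := by
      rw [← hB.eq, hBA, transpose_mul, hA.eq]
    have hA0 : A ≠ 0 := by
      rintro rfl
      simp_all
    have hmaps : ∀ y ∈ LinearMap.range A.mulVecLin, k y ∈ LinearMap.range A.mulVecLin := by
      rintro _ ⟨x, rfl⟩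
      refine ⟨(LinearMap.toMatrix' k)ᵀ *ᵥ x, ?_⟩
      rw [mulVecLin_apply, mulVec_mulVec, ← hBA', mulVecLin_apply, hkA]
    have : Nontrivial (LinearMap.range A.mulVecLin) := by
      rw [Submodule.nontrivial_iff_ne_bot, Ne, LinearMap.range_eq_bot]
      intro h0
      exact hA0 (Matrix.ext_of_mulVec_single fun i => by
        rw [zero_mulVec]
        exact LinearMap.congr_fun h0 (Pi.single i 1))
    obtain ⟨t, ht⟩ := Module.End.exists_eigenvalue (k.restrict hmaps)
    obtain ⟨⟨_, x, rfl⟩, hy⟩ := ht.exists_hasEigenvector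
    refine ⟨x, A *ᵥ x, 1, t, fun h0 => hy.2 (Subtype.ext h0), Or.inl one_ne_zero, by simp, ?_⟩
    rw [← hkA]
    exact congrArg Subtype.val hy.apply_eq_smul
  · obtain ⟨x, hx, hBx⟩ := SetLike.not_le_iff_exists.1 hker
    exact ⟨x, B *ᵥ x, 0, 1, hBx, Or.inr one_ne_zero, by simpa using hx, by simp⟩

theorem IsSymm.vecMul_eq_mulVec {R : Type*} [CommRing R] {E : Matrix n n R} (hE : E.IsSymm)
    (x : n → R) : x ᵥ* E = E *ᵥ x := by
  rw [← mulVec_transpose, hE.eq]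

theorem IsSymm.one_sub_vecMulVec_mul {K : Type*} [Field K] [DecidableEq n] {E : Matrix n n K}
    (hE : E.IsSymm) {x v : n → K} {g : K} (hx : E *ᵥ x = g • v) :
    (1 - vecMulVec ((x ⬝ᵥ v)⁻¹ • v) x) * E = E - (g / (x ⬝ᵥ v)) • vecMulVec v v := by
  rw [sub_mul, one_mul, vecMulVec_mul, hE.vecMul_eq_mulVec, hx, smul_vecMulVec, vecMulVec_smul,
    smul_smul, div_eq_inv_mul]

theorem IsSymm.rank_sub_vecMulVec_lt {K : Type*} [Field K] [DecidableEq n] {E : Matrix n n K}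
    (hE : E.IsSymm) {x v : n → K} {g : K} (hg : g ≠ 0) (hx : E *ᵥ x = g • v)
    (hvx : x ⬝ᵥ v ≠ 0) :
    (E - (g / (x ⬝ᵥ v)) • vecMulVec v v).rank < E.rank := by
  rw [← hE.one_sub_vecMulVec_mul hx]
  have hv : v ≠ 0 := by rintro rfl; simp at hvx
  refine rank_mul_lt_of_mulVec_eq_zero _ _ x (by simp [hx, hg, hv]) ?_
  rw [hx, mulVec_smul, sub_mulVec, one_mulVec, vecMulVec_mulVec]
  simp [smul_smul, hvx]

/-- The vector `w` for which `E - v wᵀ - w vᵀ` is the compression of `E` to `vᗮ` along `z`. -/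
def compressionVec {K : Type*} [Field K] (v z : n → K) (E : Matrix n n K) : n → K :=
  E *ᵥ z - ((z ⬝ᵥ E *ᵥ z) / 2) • v

theorem compressionVec_add_smul {K : Type*} [Field K] (v z : n → K) (A B : Matrix n n K) (t : K) :
    compressionVec v z (A + t • B) = compressionVec v z A + t • compressionVec v z B := by
  simp only [compressionVec, add_mulVec, smul_mulVec, dotProduct_add, dotProduct_smul]
  ext i
  simp
  ring

theorem IsSymm.compression_eq {K : Type*} [Field K] [CharZero K] [DecidableEq n]
    {E : Matrix n n K} (hE : E.IsSymm) (v z : n → K) :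
    (1 - vecMulVec v z) * (E * (1 - vecMulVec z v)) =
      E - (vecMulVec v (compressionVec v z E) + vecMulVec (compressionVec v z E) v) := by
  rw [mul_sub, mul_one, mul_vecMulVec, sub_mul, one_mul, mul_sub, vecMulVec_mul,
    vecMulVec_mul_vecMulVec, hE.vecMul_eq_mulVec]
  ext i j
  simp [compressionVec, vecMulVec_apply]
  ring

theorem IsSymm.rank_compression_add_two_le {K : Type*} [Field K] [CharZero K] [DecidableEq n]
    {E : Matrix n n K} (hE : E.IsSymm) {x v z : n → K} {g : K} (hg : g ≠ 0)
    (hx : E *ᵥ x = g • v) (hvx : x ⬝ᵥ v = 0) (hzv : z ⬝ᵥ v = 1) :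
    (E - (vecMulVec v (compressionVec v z E) + vecMulVec (compressionVec v z E) v)).rank + 2
      ≤ E.rank := by
  rw [← hE.compression_eq]
  have hv : v ≠ 0 := by rintro rfl; simp at hzv
  have hP : (1 - vecMulVec v z) *ᵥ (g • v) = 0 := by
    rw [mulVec_smul, sub_mulVec, one_mulVec, vecMulVec_mulVec]
    simp [hzv]
  have hPx : (E * (1 - vecMulVec z v)) *ᵥ x = g • v := by
    rw [← mulVec_mulVec, sub_mulVec, one_mulVec, vecMulVec_mulVec, dotProduct_comm v x, hvx]
    simpa using hx
  have h₁ := rank_mul_lt_of_mulVec_eq_zero (1 - vecMulVec v z) E x (by simp [hx, hg, hv])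
    (by rw [hx, hP])
  have h₂ := rank_mul_lt_of_mulVec_eq_zero (1 - vecMulVec v z) (E * (1 - vecMulVec z v)) x
    (by simp [hPx, hg, hv]) (by rw [hPx, hP])
  have h₃ : (E * (1 - vecMulVec z v)).rank = ((1 - vecMulVec v z) * E).rank := by
    rw [← rank_transpose]
    simp [transpose_mul, hE.eq, transpose_vecMulVec]
  omega

end Matrix

/-- The conclusion of the decomposition theorem, for the pencil `A + λ B` and the rank `r`. -/
def HasRankOneDecomposition (n r : ℕ) (A B : Matrix (Fin n) (Fin n) ℂ) : Prop :=
  ∃ (ℓ s : ℕ), ℓ + 2 * s = r ∧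
    ∃ (a b : Fin ℓ → ℂ) (u : Fin ℓ → Fin n → ℂ)
      (v c d : Fin s → Fin n → ℂ),
      ∀ lam : ℂ,
        A + lam • B =
          (∑ i : Fin ℓ, (a i + lam * b i) • vecMulVec (u i) (u i))
          + ∑ j : Fin s,
              (vecMulVec (v j) (c j + lam • d j)
                + vecMulVec (c j + lam • d j) (v j))

namespace HasRankOneDecomposition

variable {n r : ℕ} {A B A' B' : Matrix (Fin n) (Fin n) ℂ}

theorem zero (n r : ℕ) : HasRankOneDecomposition n r 0 0 :=
  ⟨r, 0, by simp, 0, 0, 0, 0, 0, 0, by simp⟩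

theorem add_square (h : HasRankOneDecomposition n r A' B') (p q : ℂ) (w : Fin n → ℂ)
    (hAB : ∀ t : ℂ, A + t • B = A' + t • B' + (p + t * q) • vecMulVec w w) :
    HasRankOneDecomposition n (r + 1) A B := by
  obtain ⟨ℓ, s, hr, a, b, u, v, c, d, h⟩ := h
  refine ⟨ℓ + 1, s, by omega, Fin.cons p a, Fin.cons q b, Fin.cons w u, v, c, d, fun t => ?_⟩
  rw [hAB, h, Fin.sum_univ_succ]
  simp only [Fin.cons_zero, Fin.cons_succ]
  abel

theorem add_hyperbolic (h : HasRankOneDecomposition n r A' B') (w e f : Fin n → ℂ)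
    (hAB : ∀ t : ℂ, A + t • B =
      A' + t • B' + (vecMulVec w (e + t • f) + vecMulVec (e + t • f) w)) :
    HasRankOneDecomposition n (r + 2) A B := by
  obtain ⟨ℓ, s, hr, a, b, u, v, c, d, h⟩ := h
  refine ⟨ℓ, s + 1, by omega, a, b, u, Fin.cons w v, Fin.cons e c, Fin.cons f d, fun t => ?_⟩
  rw [hAB, h, Fin.sum_univ_succ]
  simp only [Fin.cons_zero, Fin.cons_succ]
  abel

end HasRankOneDecomposition

theorem eventually_cofinite_add_mul_ne_zero_s2 {K : Type*} [Field K] {p q : K}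
    (hpq : p ≠ 0 ∨ q ≠ 0) : ∀ᶠ t in cofinite, p + t * q ≠ 0 := by
  by_cases hq : q = 0
  · simp_all
  · filter_upwards [(Set.finite_singleton (-p / q)).compl_mem_cofinite] with t ht h
    exact ht (by rw [Set.mem_singleton_iff, eq_div_iff hq]; linear_combination h)

/-- A rank bound at all but finitely many points suffices for the decomposition. -/
theorem hasRankOneDecomposition_of_eventually_rank_le {n : ℕ} (r : ℕ) :
    ∀ A B : Matrix (Fin n) (Fin n) ℂ, A.IsSymm → B.IsSymm →
      (∀ᶠ t : ℂ in cofinite, (A + t • B).rank ≤ r) → HasRankOneDecomposition n r A B := by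
  induction r using Nat.strong_induction_on with
  | _ r ih =>
  intro A B hA hB hr
  by_cases h0 : A = 0 ∧ B = 0
  · rw [h0.1, h0.2]
    exact .zero n r
  obtain ⟨x, v, p, q, hv, hpq, hAx, hBx⟩ :=
    exists_mulVec_eq_smul_of_isSymm hA hB (by tauto)
  have hE (t : ℂ) : (A + t • B).IsSymm := hA.add (hB.smul t)
  have hEx (t : ℂ) : (A + t • B) *ᵥ x = (p + t * q) • v := by
    rw [add_mulVec, smul_mulVec, hAx, hBx, smul_smul, add_smul]
  have hne := eventually_cofinite_add_mul_ne_zero_s2 hpq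
  by_cases hvx : x ⬝ᵥ v = 0
  · obtain ⟨z, hzv⟩ : ∃ z : Fin n → ℂ, z ⬝ᵥ v = 1 := by
      obtain ⟨i, hi⟩ := Function.ne_iff.1 hv
      exact ⟨Pi.single i (v i)⁻¹, by simpa using inv_mul_cancel₀ hi⟩
    let compress (M : Matrix (Fin n) (Fin n) ℂ) : Matrix (Fin n) (Fin n) ℂ :=
      M - (vecMulVec v (compressionVec v z M) + vecMulVec (compressionVec v z M) v)
    have hsymm {M} (hM : M.IsSymm) : (compress M).IsSymm := by
      refine hM.sub ?_
      simp [IsSymm, transpose_vecMulVec, add_comm]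
    have hcomp (t : ℂ) : compress A + t • compress B = compress (A + t • B) := by
      simp only [compress, compressionVec_add_smul, vecMulVec_add, add_vecMulVec, vecMulVec_smul,
        smul_vecMulVec, smul_sub, smul_add]
      abel
    have hdrop : ∀ᶠ t : ℂ in cofinite, (compress A + t • compress B).rank + 2 ≤ r := by
      filter_upwards [hr, hne] with t ht hg
      rw [hcomp]
      exact ((hE t).rank_compression_add_two_le hg (hEx t) hvx hzv).trans ht
    obtain ⟨r, rfl⟩ : ∃ m, r = m + 2 := by
      obtain ⟨t, ht⟩ := hdrop.exists
      exact ⟨r - 2, by omega⟩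
    refine (ih r (by omega) (compress A) (compress B) (hsymm hA) (hsymm hB)
      (hdrop.mono fun t ht => by omega)).add_hyperbolic v (compressionVec v z A)
      (compressionVec v z B) fun t => ?_
    rw [hcomp, ← compressionVec_add_smul, sub_add_cancel]
  · have hcomp (t : ℂ) : A - (p / (x ⬝ᵥ v)) • vecMulVec v v
          + t • (B - (q / (x ⬝ᵥ v)) • vecMulVec v v)
        = A + t • B - ((p + t * q) / (x ⬝ᵥ v)) • vecMulVec v v := by
      rw [add_div, mul_div_assoc, add_smul, mul_smul, smul_sub]
      abel
    have hsymm (y : ℂ) : (y • vecMulVec v v).IsSymm := by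
      simp [IsSymm, transpose_vecMulVec]
    have hdrop : ∀ᶠ t : ℂ in cofinite, (A - (p / (x ⬝ᵥ v)) • vecMulVec v v
        + t • (B - (q / (x ⬝ᵥ v)) • vecMulVec v v)).rank + 1 ≤ r := by
      filter_upwards [hr, hne] with t ht hg
      rw [hcomp]
      exact ((hE t).rank_sub_vecMulVec_lt hg (hEx t) hvx).trans_le ht
    obtain ⟨r, rfl⟩ : ∃ m, r = m + 1 := by
      obtain ⟨t, ht⟩ := hdrop.exists
      exact ⟨r - 1, by omega⟩
    refine (ih r (by omega) _ _ (hA.sub (hsymm _)) (hB.sub (hsymm _))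
      (hdrop.mono fun t ht => Nat.le_of_succ_le_succ ht)).add_square
      (p / (x ⬝ᵥ v)) (q / (x ⬝ᵥ v)) v fun t => ?_
    rw [hcomp, ← mul_div_assoc, ← add_div, sub_add_cancel]

/-- **Rank-1 decomposition for complex symmetric pencils.**
If `E(λ) = A + λB` is an `n × n` complex symmetric matrix pencil of rank `r ≤ n`,
then there exist `ℓ, s` with `ℓ + 2s = r`, complex numbers `a_i, b_i`, vectors
`u_i, v_j ∈ ℂ^n` and vector pencils `w_j(λ) = c_j + λ d_j` of degree at most one
such that `A + λB = Σ (a_i + λ b_i) u_i u_iᵀ + Σ (v_j w_j(λ)ᵀ + w_j(λ) v_jᵀ)`. -/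
theorem symmetric_rank_one_decomposition
    (n r : ℕ) (hrn : r ≤ n) (A B : Matrix (Fin n) (Fin n) ℂ)
    (hA : A.IsSymm) (hB : B.IsSymm)
    (hrank : PencilRankEq n A B r) :
    ∃ (ℓ s : ℕ), ℓ + 2 * s = r ∧
      ∃ (a b : Fin ℓ → ℂ) (u : Fin ℓ → Fin n → ℂ)
        (v c d : Fin s → Fin n → ℂ),
        ∀ lam : ℂ,
          A + lam • B =
            (∑ i : Fin ℓ, (a i + lam * b i) • vecMulVec (u i) (u i))
            + ∑ j : Fin s,
                (vecMulVec (v j) (c j + lam • d j)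
                  + vecMulVec (c j + lam • d j) (v j)) := by
  exact hasRankOneDecomposition_of_eventually_rank_le r A B hA hB (Eventually.of_forall hrank.2)
end

section
/- Let E(λ)=A+λB be an n×n complex skew-symmetric matrix pencil (i.e., A^T=−A, B^T=−B) whose rank equals r (r ≤ n). Then r is even and, with s=r/2, there exist vectors v_1,…,v_s ∈ ℂ^n and vector pencils w_1,…,w_s of degree at most one such that A+λB = Σ_{j=1}^{s} ( v_j w_j(λ)^T − w_j(λ) v_j^T ). -/
open Matrix BigOperators

section SkewPencil

variable {n : ℕ}

lemma mulVec_dotProduct_of_transpose_eq_neg {M : Matrix (Fin n) (Fin n) ℂ} (hM : Mᵀ = -M)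
    (x y : Fin n → ℂ) : M *ᵥ x ⬝ᵥ y = -(x ⬝ᵥ M *ᵥ y) := by
  have h : x ᵥ* M = -(M *ᵥ x) := by
    rw [← mulVec_transpose, hM, neg_mulVec]
  rw [dotProduct_mulVec, h, neg_dotProduct, neg_neg]

lemma mulVec_dotProduct_self_of_transpose_eq_neg {M : Matrix (Fin n) (Fin n) ℂ} (hM : Mᵀ = -M)
    (x : Fin n → ℂ) : M *ᵥ x ⬝ᵥ x = 0 := by
  have h := mulVec_dotProduct_of_transpose_eq_neg hM x x
  rw [dotProduct_comm x] at h
  exact self_eq_neg.mp h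

/-- The range of `M` loses at least the two dimensions detected by pairing with `x` and `y`. -/
lemma rank_add_two_le {M M' : Matrix (Fin n) (Fin n) ℂ} {x y p q : Fin n → ℂ}
    (hle : M'.mulVecLin.range ≤ M.mulVecLin.range)
    (hx : ∀ u, M' *ᵥ u ⬝ᵥ x = 0) (hy : ∀ u, M' *ᵥ u ⬝ᵥ y = 0)
    (hp : p ∈ M.mulVecLin.range) (hq : q ∈ M.mulVecLin.range)
    (hpx : p ⬝ᵥ x = 0) (hpy : p ⬝ᵥ y ≠ 0) (hqx : q ⬝ᵥ x ≠ 0) (hqy : q ⬝ᵥ y = 0) :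
    M'.rank + 2 ≤ M.rank := by
  let φ : (Fin n → ℂ) →ₗ[ℂ] ℂ × ℂ :=
    ((dotProductBilin ℂ ℂ).flip x).prod ((dotProductBilin ℂ ℂ).flip y)
  have hφ : ∀ u, φ u = (u ⬝ᵥ x, u ⬝ᵥ y) := fun u => rfl
  let R := M.mulVecLin.range
  let ψ : R →ₗ[ℂ] ℂ × ℂ := φ.domRestrict R
  have hsurj : ψ.range = ⊤ := by
    rw [LinearMap.range_eq_top]
    rintro ⟨a, b⟩
    refine ⟨(a / (q ⬝ᵥ x)) • ⟨q, hq⟩ + (b / (p ⬝ᵥ y)) • ⟨p, hp⟩, ?_⟩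
    change φ ((a / (q ⬝ᵥ x)) • q + (b / (p ⬝ᵥ y)) • p) = _
    rw [hφ]
    simp [add_dotProduct, smul_dotProduct, hpx, hqy, hpy, hqx]
  have hker : M'.mulVecLin.range ≤ ψ.ker.map R.subtype := by
    rintro v hv
    obtain ⟨u, rfl⟩ := hv
    refine ⟨⟨_, hle ⟨u, rfl⟩⟩, ?_, rfl⟩
    change φ (M' *ᵥ u) = 0
    rw [hφ, hx, hy]; rfl
  have h1 := ψ.finrank_range_add_finrank_ker
  rw [hsurj, finrank_top, Module.finrank_prod, Module.finrank_self] at h1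
  have h2 := Submodule.finrank_mono hker
  have h3 := Submodule.finrank_map_le R.subtype ψ.ker
  change Module.finrank ℂ M'.mulVecLin.range + 2 ≤ Module.finrank ℂ R
  omega

/-- Peeling a skew rank-two term `q pᵀ - p qᵀ`, with `q = M y`, off a skew-symmetric matrix whose
range contains `p` lowers the rank by at least two. -/
lemma rank_peel_add_two_le {M : Matrix (Fin n) (Fin n) ℂ} (hM : Mᵀ = -M) {x y p : Fin n → ℂ}
    {γ : ℂ} (hγ : γ ≠ 0) (hx : M *ᵥ x = γ • p) (hpy : p ⬝ᵥ y = 1) :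
    (M + (vecMulVec p (M *ᵥ y) - vecMulVec (M *ᵥ y) p)).rank + 2 ≤ M.rank := by
  have hpx : p ⬝ᵥ x = 0 := by
    have h := mulVec_dotProduct_self_of_transpose_eq_neg hM x
    rw [hx, smul_dotProduct, smul_eq_mul] at h
    exact (mul_eq_zero.mp h).resolve_left hγ
  have hqy := mulVec_dotProduct_self_of_transpose_eq_neg hM y
  have hqx : M *ᵥ y ⬝ᵥ x = -γ := by
    rw [mulVec_dotProduct_of_transpose_eq_neg hM, hx, dotProduct_smul, dotProduct_comm, hpy]
    simp
  have hp : p = M *ᵥ (γ⁻¹ • x) := by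
    rw [mulVec_smul, hx, smul_smul, inv_mul_cancel₀ hγ, one_smul]
  have hmul : ∀ u, (M + (vecMulVec p (M *ᵥ y) - vecMulVec (M *ᵥ y) p)) *ᵥ u =
      M *ᵥ u + ((M *ᵥ y ⬝ᵥ u) • p - (p ⬝ᵥ u) • (M *ᵥ y)) := by
    intro u
    simp [add_mulVec, sub_mulVec, vecMulVec_mulVec]
  refine rank_add_two_le (x := x) (y := y) (p := p) (q := M *ᵥ y) ?_ ?_ ?_ ⟨_, hp.symm⟩
    ⟨y, rfl⟩ hpx (by simp [hpy]) (by simpa [hqx] using hγ) hqy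
  · rintro _ ⟨u, rfl⟩
    refine ⟨u + ((M *ᵥ y ⬝ᵥ u) • (γ⁻¹ • x) - (p ⬝ᵥ u) • y), ?_⟩
    simp only [mulVecLin_apply]
    rw [hmul, mulVec_add, mulVec_sub, mulVec_smul M (M *ᵥ y ⬝ᵥ u), ← hp,
      mulVec_smul M (p ⬝ᵥ u)]
  · intro u
    rw [hmul, add_dotProduct, sub_dotProduct, smul_dotProduct, smul_dotProduct, hpx, hqx,
      mulVec_dotProduct_of_transpose_eq_neg hM, hx, dotProduct_smul, dotProduct_comm u]
    simp only [smul_eq_mul]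
    ring
  · intro u
    rw [hmul, add_dotProduct, sub_dotProduct, smul_dotProduct, smul_dotProduct, hpy, hqy,
      mulVec_dotProduct_of_transpose_eq_neg hM u, dotProduct_comm u]
    simp

lemma exists_eq_mul_of_ker_le_ker {A B : Matrix (Fin n) (Fin n) ℂ}
    (h : B.mulVecLin.ker ≤ A.mulVecLin.ker) : ∃ C : Matrix (Fin n) (Fin n) ℂ, A = C * B := by
  obtain ⟨g, hg⟩ := B.mulVecLin.rangeRestrict.exists_rightInverse_of_surjective
    B.mulVecLin.range_rangeRestrict
  obtain ⟨c, hc⟩ := (A.mulVecLin ∘ₗ g).exists_extend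
  refine ⟨LinearMap.toMatrix' c, Matrix.mulVec_injective (funext fun x => ?_)⟩
  have hgx : B *ᵥ g (B.mulVecLin.rangeRestrict x) = B *ᵥ x :=
    congrArg Subtype.val (LinearMap.congr_fun hg (B.mulVecLin.rangeRestrict x))
  have hker : x - g (B.mulVecLin.rangeRestrict x) ∈ A.mulVecLin.ker :=
    h (by simp [mulVec_sub, hgx])
  have hcx : c (B *ᵥ x) = A *ᵥ g (B.mulVecLin.rangeRestrict x) :=
    LinearMap.congr_fun hc (B.mulVecLin.rangeRestrict x)
  rw [LinearMap.mem_ker, mulVecLin_apply, mulVec_sub, sub_eq_zero] at hker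
  rw [← mulVec_mulVec, LinearMap.toMatrix'_mulVec, hcx, hker]

/-- A nonzero skew-symmetric pencil has an eigenvector outside its common kernel. -/
lemma exists_pencil_eigenvector {A B : Matrix (Fin n) (Fin n) ℂ} (hA : Aᵀ = -A) (hB : Bᵀ = -B)
    (hne : A ≠ 0 ∨ B ≠ 0) :
    ∃ (x p : Fin n → ℂ) (α β : ℂ), p ≠ 0 ∧ (α ≠ 0 ∨ β ≠ 0) ∧
      A *ᵥ x = α • p ∧ B *ᵥ x = β • p := by
  by_cases hker : B.mulVecLin.ker ≤ A.mulVecLin.ker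
  · obtain ⟨C, hC⟩ := exists_eq_mul_of_ker_le_ker hker
    have hA' : A = B * Cᵀ := by
      have h := congrArg transpose hC
      rw [transpose_mul, hA, hB, neg_mul] at h
      exact neg_injective h
    have hBne : B ≠ 0 := by
      rintro rfl
      exact hne.elim (fun h => h (by simpa using hC)) (fun h => h rfl)
    have hmaps : ∀ u ∈ B.mulVecLin.range, C.mulVecLin u ∈ B.mulVecLin.range := by
      rintro _ ⟨u, rfl⟩
      refine ⟨Cᵀ *ᵥ u, ?_⟩
      simp only [mulVecLin_apply, mulVec_mulVec]
      rw [← hA', ← hC]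
    have : Nontrivial B.mulVecLin.range := by
      rw [Submodule.nontrivial_iff_ne_bot, Ne, LinearMap.range_eq_bot]
      intro h
      exact hBne (Matrix.mulVec_injective (funext fun u => by
        simpa using LinearMap.congr_fun h u))
    obtain ⟨α, hα⟩ := Module.End.exists_eigenvalue (C.mulVecLin.restrict hmaps)
    obtain ⟨⟨p, x, hx⟩, hp⟩ := hα.exists_hasEigenvector
    have hCp : C *ᵥ p = α • p := congrArg Subtype.val hp.apply_eq_smul
    rw [mulVecLin_apply] at hx
    refine ⟨x, p, α, 1, fun h => hp.2 (Subtype.ext h), Or.inr one_ne_zero, ?_, by simpa using hx⟩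
    rw [hC, ← mulVec_mulVec, hx, hCp]
  · obtain ⟨x, hxB, hxA⟩ := SetLike.not_le_iff_exists.mp hker
    exact ⟨x, A *ᵥ x, 1, 0, hxA, Or.inl one_ne_zero, by simp, by simpa using hxB⟩

lemma finite_add_mul_eq_zero {α β : ℂ} (h : α ≠ 0 ∨ β ≠ 0) : {μ : ℂ | α + μ * β = 0}.Finite := by
  refine Set.Subsingleton.finite fun a ha b hb => ?_
  simp only [Set.mem_ofPred_eq] at ha hb
  have hβ : β ≠ 0 := by
    rintro rfl
    simp_all
  exact mul_right_cancel₀ hβ (by linear_combination ha - hb)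

open Filter in
/-- A skew-symmetric pencil of generic rank at most `r` is a sum of at most `r / 2` skew terms. -/
lemma exists_skew_decomposition (r : ℕ) : ∀ (A B : Matrix (Fin n) (Fin n) ℂ),
    Aᵀ = -A → Bᵀ = -B → (∀ᶠ μ : ℂ in cofinite, (A + μ • B).rank ≤ r) →
    ∃ s : ℕ, 2 * s ≤ r ∧ ∃ v c d : Fin s → Fin n → ℂ, ∀ lam : ℂ,
      A + lam • B = ∑ j : Fin s,
        (vecMulVec (v j) (c j + lam • d j) - vecMulVec (c j + lam • d j) (v j)) := by
  induction r using Nat.strong_induction_on with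
  | _ r ih =>
    intro A B hA hB hr
    by_cases h0 : A = 0 ∧ B = 0
    · exact ⟨0, by simp, 0, 0, 0, fun lam => by simp [h0.1, h0.2]⟩
    obtain ⟨x, p, α, β, hp, hαβ, hAx, hBx⟩ :=
      exists_pencil_eigenvector hA hB (not_and_or.mp h0)
    obtain ⟨i, hi⟩ := Function.ne_iff.mp hp
    obtain ⟨y, hpy⟩ : ∃ y, p ⬝ᵥ y = 1 :=
      ⟨Pi.single i (p i)⁻¹, by simpa using mul_inv_cancel₀ hi⟩
    let peel (M : Matrix (Fin n) (Fin n) ℂ) : Matrix (Fin n) (Fin n) ℂ :=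
      M + (vecMulVec p (M *ᵥ y) - vecMulVec (M *ᵥ y) p)
    have hpeel_skew : ∀ M : Matrix (Fin n) (Fin n) ℂ, Mᵀ = -M → (peel M)ᵀ = -peel M := by
      intro M hM
      simp only [peel, transpose_add, transpose_sub, transpose_vecMulVec, hM]
      abel
    have hpeel_add : ∀ μ : ℂ, peel A + μ • peel B = peel (A + μ • B) := by
      intro μ
      simp only [peel, add_mulVec, smul_mulVec, vecMulVec_add, add_vecMulVec, vecMulVec_smul,
        smul_vecMulVec, smul_add, smul_sub]
      abel
    have hrank : ∀ᶠ μ : ℂ in cofinite, (peel A + μ • peel B).rank + 2 ≤ r := by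
      filter_upwards [hr, (finite_add_mul_eq_zero hαβ).compl_mem_cofinite] with μ hμ hγ
      rw [hpeel_add]
      refine (rank_peel_add_two_le (x := x) (γ := α + μ * β) ?_ hγ ?_ hpy).trans hμ
      · rw [transpose_add, transpose_smul, hA, hB, smul_neg, neg_add]
      · rw [add_mulVec, smul_mulVec, hAx, hBx, smul_smul, add_smul]
    have hr2 : 2 ≤ r := by
      obtain ⟨μ, hμ⟩ := hrank.exists
      omega
    obtain ⟨s, hs, v, c, d, h⟩ := ih (r - 2) (by omega) (peel A) (peel B) (hpeel_skew A hA)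
      (hpeel_skew B hB) (hrank.mono fun μ hμ => by omega)
    refine ⟨s + 1, by omega, Fin.cons p v, Fin.cons (-(A *ᵥ y)) c, Fin.cons (-(B *ᵥ y)) d,
      fun lam => ?_⟩
    rw [Fin.sum_univ_succ]
    simp only [Fin.cons_zero, Fin.cons_succ]
    rw [← h lam, hpeel_add]
    simp only [peel, add_mulVec, smul_mulVec, smul_neg, ← neg_add, vecMulVec_neg, neg_vecMulVec]
    abel

lemma rank_add_le_rank_add_rank (M N : Matrix (Fin n) (Fin n) ℂ) :
    (M + N).rank ≤ M.rank + N.rank := by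
  have h : (M + N).mulVecLin.range ≤ M.mulVecLin.range ⊔ N.mulVecLin.range := by
    rintro _ ⟨u, rfl⟩
    rw [mulVecLin_apply, add_mulVec]
    exact Submodule.add_mem_sup ⟨u, rfl⟩ ⟨u, rfl⟩
  exact (Submodule.finrank_mono h).trans (Submodule.finrank_add_le_finrank_add_finrank _ _)

lemma rank_sum_skew_le {s : ℕ} (v w : Fin s → Fin n → ℂ) :
    (∑ j, (vecMulVec (v j) (w j) - vecMulVec (w j) (v j))).rank ≤ 2 * s := by
  have h : ∀ t : Finset (Fin s),
      (∑ j ∈ t, (vecMulVec (v j) (w j) - vecMulVec (w j) (v j))).rank ≤ 2 * t.card := by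
    intro t
    induction t using Finset.induction_on with
    | empty => simp
    | insert a t ha ih =>
      rw [Finset.sum_insert ha, Finset.card_insert_of_notMem ha, sub_eq_add_neg,
        ← neg_vecMulVec]
      have h1 := rank_add_le_rank_add_rank (vecMulVec (v a) (w a) + vecMulVec (-w a) (v a))
        (∑ j ∈ t, (vecMulVec (v j) (w j) - vecMulVec (w j) (v j)))
      have h2 := rank_add_le_rank_add_rank (vecMulVec (v a) (w a)) (vecMulVec (-w a) (v a))
      have h3 := rank_vecMulVec_le (v a) (w a)
      have h4 := rank_vecMulVec_le (-w a) (v a)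
      omega
  simpa using h Finset.univ

end SkewPencil

/-- **Rank-1 decomposition for complex skew-symmetric pencils.**
If `E(λ) = A + λB` is an `n × n` complex skew-symmetric matrix pencil of rank
`r ≤ n`, then `r` is even and, with `s = r/2`, there exist vectors `v_j ∈ ℂ^n` and
vector pencils `w_j(λ) = c_j + λ d_j` of degree at most one such that
`A + λB = Σ_{j=1}^{s} (v_j w_j(λ)ᵀ − w_j(λ) v_jᵀ)`. -/
theorem skew_symmetric_rank_one_decomposition
    (n r : ℕ) (hrn : r ≤ n) (A B : Matrix (Fin n) (Fin n) ℂ)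
    (hA : Aᵀ = -A) (hB : Bᵀ = -B)
    (hrank : PencilRankEq n A B r) :
    ∃ s : ℕ, r = 2 * s ∧
      ∃ (v c d : Fin s → Fin n → ℂ),
        ∀ lam : ℂ,
          A + lam • B =
            ∑ j : Fin s,
              (vecMulVec (v j) (c j + lam • d j)
                - vecMulVec (c j + lam • d j) (v j)) := by
  obtain ⟨⟨μ, hμ⟩, hle⟩ := hrank
  obtain ⟨s, hs, v, c, d, h⟩ :=
    exists_skew_decomposition r A B hA hB (Filter.Eventually.of_forall hle)
  have hrs : (A + μ • B).rank ≤ 2 * s := by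
    rw [h μ]
    exact rank_sum_skew_le v fun j => c j + μ • d j
  exact ⟨s, by omega, v, c, d, h⟩
end

section
/- Let E(λ)=A+λB be an n×n ⊤-even matrix pencil over ℂ (i.e., A^T=A, B^T=−B) whose rank equals r (r ≤ n), and set s=⌊r/2⌋. Then there exist vectors v_1,…,v_s ∈ ℂ^n, vector pencils w_1,…,w_s of degree at most one, and (if r is odd) a vector u ∈ ℂ^n, such that A+λB = Σ_{j=1}^{s} ( v_j w_j(λ)^T + w_j(−λ) v_j^T ) if r is even, and A+λB = u u^T + Σ_{j=1}^{s} ( v_j w_j(λ)^T + w_j(−λ) v_j^T ) if r is odd. -/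
open Matrix BigOperators

section Pencil

variable {ι : Type*} [Fintype ι] {A B : Matrix ι ι ℂ}

theorem dotProduct_mulVec_comm_of_isSymm (hA : Aᵀ = A) (x y : ι → ℂ) :
    x ⬝ᵥ A *ᵥ y = y ⬝ᵥ A *ᵥ x := by
  rw [dotProduct_mulVec, ← mulVec_transpose, hA, dotProduct_comm]

theorem dotProduct_mulVec_comm_of_isSkew (hB : Bᵀ = -B) (x y : ι → ℂ) :
    x ⬝ᵥ B *ᵥ y = -(y ⬝ᵥ B *ᵥ x) := by
  rw [dotProduct_mulVec, ← mulVec_transpose, hB, dotProduct_comm, neg_mulVec, dotProduct_neg]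

/-- If the column space of `M'` lies in that of `M` and is orthogonal to `x` and `y`, and the
form of `M` on the plane spanned by `x` and `y` is anti-triangular and nonsingular, then passing
from `M` to `M'` drops the rank by at least two. -/
theorem rank_add_two_le_rank {M M' : Matrix ι ι ℂ} {x y : ι → ℂ}
    (hrange : ∀ z, M' *ᵥ z ∈ LinearMap.range M.mulVecLin)
    (hx : ∀ z, x ⬝ᵥ M' *ᵥ z = 0) (hy : ∀ z, y ⬝ᵥ M' *ᵥ z = 0)
    (hxx : x ⬝ᵥ M *ᵥ x = 0) (hyx : y ⬝ᵥ M *ᵥ x ≠ 0) (hxy : x ⬝ᵥ M *ᵥ y ≠ 0) :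
    M'.rank + 2 ≤ M.rank := by
  let S := LinearMap.range M.mulVecLin ⊓ LinearMap.ker (dotProductBilin ℂ ℂ x)
  have hlt : S < LinearMap.range M.mulVecLin := by
    refine lt_of_le_of_ne inf_le_left fun h => hxy ?_
    have hmem : M *ᵥ y ∈ S := h ▸ ⟨y, rfl⟩
    exact hmem.2
  have hlt' : LinearMap.range M'.mulVecLin < S := by
    refine lt_of_le_of_ne ?_ fun h => hyx ?_
    · rintro _ ⟨z, rfl⟩
      exact ⟨hrange z, hx z⟩
    · have hmem : M *ᵥ x ∈ LinearMap.range M'.mulVecLin := h ▸ ⟨⟨x, rfl⟩, hxx⟩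
      obtain ⟨z, hz⟩ := hmem
      rw [← hz]
      exact hy z
  have h₁ := Submodule.finrank_lt_finrank_of_lt hlt
  have h₂ := Submodule.finrank_lt_finrank_of_lt hlt'
  simp only [Matrix.rank]
  omega

/-- A vector `x` with `(A + λB) x = (a + λb) v` and `x ⬝ᵥ v = 0` lets one split off a rank-two
⊤-even summand, lowering the rank of the pencil by two away from finitely many points. -/
theorem exists_deflation (hA : Aᵀ = A) (hB : Bᵀ = -B) {x v : ι → ℂ} {a b : ℂ} (hv : v ≠ 0)
    (hAx : A *ᵥ x = a • v) (hBx : B *ᵥ x = b • v) (hxv : x ⬝ᵥ v = 0) :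
    ∃ c d : ι → ℂ, ∀ μ : ℂ, a + μ * b ≠ 0 → a - μ * b ≠ 0 →
      ((A - (vecMulVec v c + vecMulVec c v)) +
        μ • (B - (vecMulVec v d - vecMulVec d v))).rank + 2 ≤ (A + μ • B).rank := by
  classical
  obtain ⟨i, hi⟩ := Function.ne_iff.mp hv
  obtain ⟨y, hyv⟩ : ∃ y : ι → ℂ, y ⬝ᵥ v = 1 :=
    ⟨Pi.single i (v i)⁻¹, by simpa using inv_mul_cancel₀ hi⟩
  set α := y ⬝ᵥ A *ᵥ y with hα
  have hyBy : y ⬝ᵥ B *ᵥ y = 0 := by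
    have := dotProduct_mulVec_comm_of_isSkew hB y y
    linear_combination this / 2
  refine ⟨A *ᵥ y - (α / 2) • v, -(B *ᵥ y), fun μ hplus hminus => ?_⟩
  have hMx : (A + μ • B) *ᵥ x = (a + μ * b) • v := by
    rw [add_mulVec, smul_mulVec, hAx, hBx, smul_smul, ← add_smul]
  have hxM (z : ι → ℂ) : x ⬝ᵥ (A + μ • B) *ᵥ z = (a - μ * b) * (v ⬝ᵥ z) := by
    rw [add_mulVec, smul_mulVec, dotProduct_add, dotProduct_smul,
      dotProduct_mulVec_comm_of_isSymm hA, dotProduct_mulVec_comm_of_isSkew hB, hAx, hBx,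
      dotProduct_smul, dotProduct_smul, dotProduct_comm z v]
    simp only [smul_eq_mul]
    ring
  have hM' (z : ι → ℂ) :
      ((A - (vecMulVec v (A *ᵥ y - (α / 2) • v) + vecMulVec (A *ᵥ y - (α / 2) • v) v)) +
        μ • (B - (vecMulVec v (-(B *ᵥ y)) - vecMulVec (-(B *ᵥ y)) v))) *ᵥ z =
      (A + μ • B) *ᵥ z - (y ⬝ᵥ (A + μ • B) *ᵥ z - α / 2 * (v ⬝ᵥ z)) • v
        - (v ⬝ᵥ z) • ((A + μ • B) *ᵥ y - (α / 2) • v) := by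
    have h₁ : (A *ᵥ y) ⬝ᵥ z = y ⬝ᵥ A *ᵥ z := by
      rw [dotProduct_comm, dotProduct_mulVec_comm_of_isSymm hA]
    have h₂ : (B *ᵥ y) ⬝ᵥ z = -(y ⬝ᵥ B *ᵥ z) := by
      rw [dotProduct_comm, dotProduct_mulVec_comm_of_isSkew hB]
    ext j
    simp only [add_mulVec, sub_mulVec, smul_mulVec, vecMulVec_mulVec, sub_dotProduct,
      neg_dotProduct, smul_dotProduct, h₁, h₂, dotProduct_add, dotProduct_smul, Pi.add_apply,
      Pi.sub_apply, Pi.smul_apply, Pi.neg_apply, smul_eq_mul, MulOpposite.smul_eq_mul_unop,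
      MulOpposite.unop_op]
    ring
  have hvy : v ⬝ᵥ y = 1 := by rw [dotProduct_comm, hyv]
  have hyMy : y ⬝ᵥ (A + μ • B) *ᵥ y = α := by
    rw [add_mulVec, smul_mulVec, dotProduct_add, dotProduct_smul, hyBy, smul_zero, add_zero]
  have hvmem : v ∈ LinearMap.range (A + μ • B).mulVecLin := by
    refine ⟨(a + μ * b)⁻¹ • x, ?_⟩
    rw [map_smul, mulVecLin_apply, hMx, smul_smul, inv_mul_cancel₀ hplus, one_smul]
  refine rank_add_two_le_rank (x := x) (y := y) (fun z => ?_) (fun z => ?_) (fun z => ?_)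
    ?_ ?_ ?_
  · rw [hM']
    exact sub_mem (sub_mem ⟨z, rfl⟩ (Submodule.smul_mem _ _ hvmem))
      (Submodule.smul_mem _ _ (sub_mem ⟨y, rfl⟩ (Submodule.smul_mem _ _ hvmem)))
  · rw [hM']
    simp only [dotProduct_sub, dotProduct_smul, hxM, hxv, hvy, smul_eq_mul]
    ring
  · rw [hM']
    simp only [dotProduct_sub, dotProduct_smul, hyMy, hyv, smul_eq_mul]
    ring
  · rw [hMx, dotProduct_smul, hxv, smul_zero]
  · rw [hMx, dotProduct_smul, hyv, smul_eq_mul, mul_one]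
    exact hplus
  · rw [hxM, hvy, mul_one]
    exact hminus

/-- A symmetric form whose isotropic vectors in a subspace all lie in its kernel agrees with a
square `u uᵀ` on that subspace. -/
theorem exists_sub_vecMulVec_mulVec_eq_zero (hA : Aᵀ = A) (N : Submodule ℂ (ι → ℂ))
    (hN : ∀ x ∈ N, x ⬝ᵥ A *ᵥ x = 0 → A *ᵥ x = 0) :
    ∃ y ∈ N, (y = 0 ∨ y ⬝ᵥ A *ᵥ y = 1) ∧
      ∀ z ∈ N, (A - vecMulVec (A *ᵥ y) (A *ᵥ y)) *ᵥ z = 0 := by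
  by_cases h : ∀ z ∈ N, A *ᵥ z = 0
  · exact ⟨0, zero_mem _, Or.inl rfl, fun z hz => by simp [h z hz]⟩
  push Not at h
  obtain ⟨x, hxN, hx⟩ := h
  obtain ⟨t, ht⟩ := IsAlgClosed.exists_pow_nat_eq (x ⬝ᵥ A *ᵥ x) zero_lt_two
  have ht0 : t ≠ 0 := by
    rintro rfl
    exact hx (hN x hxN (by rw [← ht]; simp))
  set y := t⁻¹ • x with hy
  have hyN : y ∈ N := N.smul_mem _ hxN
  have hyy : y ⬝ᵥ A *ᵥ y = 1 := by
    simp only [hy, mulVec_smul, dotProduct_smul, smul_dotProduct, ← ht, smul_eq_mul]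
    field_simp
  refine ⟨y, hyN, Or.inr hyy, fun z hz => ?_⟩
  set k := y ⬝ᵥ A *ᵥ z with hk
  set z' := z - k • y with hz'
  have hz'N : z' ∈ N := N.sub_mem hz (N.smul_mem _ hyN)
  have hyz' : y ⬝ᵥ A *ᵥ z' = 0 := by
    simp [hz', mulVec_sub, mulVec_smul, hyy, ← hk]
  have hz'y : z' ⬝ᵥ A *ᵥ y = 0 := by rw [dotProduct_mulVec_comm_of_isSymm hA, hyz']
  obtain ⟨q, hq⟩ := IsAlgClosed.exists_pow_nat_eq (-(z' ⬝ᵥ A *ᵥ z')) zero_lt_two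
  have hiso : A *ᵥ (z' + q • y) = 0 := by
    refine hN _ (N.add_mem hz'N (N.smul_mem _ hyN)) ?_
    simp only [mulVec_add, mulVec_smul, dotProduct_add, add_dotProduct, dotProduct_smul,
      smul_dotProduct, hyz', hz'y, hyy, smul_eq_mul]
    linear_combination hq
  have hq0 : q = 0 := by
    have := congrArg (y ⬝ᵥ ·) hiso
    simpa [mulVec_add, mulVec_smul, hyz', hyy] using this
  have hAz : A *ᵥ z = k • A *ᵥ y := by
    rw [hq0, zero_smul, add_zero, hz', mulVec_sub, mulVec_smul, sub_eq_zero] at hiso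
    exact hiso
  rw [sub_mulVec, vecMulVec_mulVec, dotProduct_comm, dotProduct_mulVec_comm_of_isSymm hA, ← hk,
    hAz]
  ext j
  simp

/-- If `A` is symmetric, `B ≠ 0` is skew-symmetric and `ker B ≤ ker A`, then the pencil
`A - λB` has a finite eigenvalue with an eigenvector outside `ker B`. -/
theorem exists_mulVec_eq_smul_mulVec (hA : Aᵀ = A) (hB : Bᵀ = -B) (hB0 : B ≠ 0)
    (hker : ∀ z, B *ᵥ z = 0 → A *ᵥ z = 0) :
    ∃ (x : ι → ℂ) (a : ℂ), B *ᵥ x ≠ 0 ∧ A *ᵥ x = a • B *ᵥ x := by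
  classical
  obtain ⟨f, hf⟩ : ∃ f : (ι → ℂ) →ₗ[ℂ] (ι → ℂ), f ∘ₗ B.mulVecLin = A.mulVecLin := by
    obtain ⟨f, hf⟩ := LinearMap.exists_extend
      (((LinearMap.ker B.mulVecLin).liftQ A.mulVecLin hker).comp
        B.mulVecLin.quotKerEquivRange.symm.toLinearMap)
    refine ⟨f, LinearMap.ext fun x => ?_⟩
    have hx := LinearMap.congr_fun hf ⟨B.mulVecLin x, x, rfl⟩
    have hsymm : B.mulVecLin.quotKerEquivRange.symm ⟨B.mulVecLin x, x, rfl⟩ =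
        Submodule.Quotient.mk x :=
      B.mulVecLin.quotKerEquivRange_symm_apply_image x ⟨x, rfl⟩
    rw [LinearMap.comp_apply, LinearMap.comp_apply, LinearEquiv.coe_coe, hsymm] at hx
    exact hx
  set C := LinearMap.toMatrix' f with hC
  have hCB : A = C * B := by
    apply Matrix.toLin'.injective
    rw [toLin'_mul, hC, toLin'_toMatrix', toLin'_apply', toLin'_apply', hf]
  have hBC : A = B * -Cᵀ := by
    rw [← hA, hCB, transpose_mul, hB, neg_mul, mul_neg]
  let R := LinearMap.range B.mulVecLin
  have hR : ∀ w ∈ R, f w ∈ R := by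
    rintro _ ⟨x, rfl⟩
    refine ⟨-Cᵀ *ᵥ x, ?_⟩
    rw [← LinearMap.comp_apply, hf, mulVecLin_apply, mulVecLin_apply, mulVec_mulVec, ← hBC]
  have hRnt : Nontrivial R := by
    rw [Submodule.nontrivial_iff_ne_bot]
    intro h
    apply hB0
    apply Matrix.toLin'.injective
    rw [map_zero, toLin'_apply', LinearMap.range_eq_bot.mp h]
  obtain ⟨a, ha⟩ := Module.End.exists_eigenvalue (f.restrict hR)
  obtain ⟨⟨_, x, rfl⟩, hw⟩ := ha.exists_hasEigenvector
  refine ⟨x, a, fun h => hw.2 (Subtype.ext h), ?_⟩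
  rw [← mulVecLin_apply A, ← hf]
  exact congrArg Subtype.val hw.apply_eq_smul

/-- A ⊤-even pencil either admits a deflating vector or is a constant square `u uᵀ`. -/
theorem exists_deflating_vector_or_eq_vecMulVec (hA : Aᵀ = A) (hB : Bᵀ = -B) :
    (∃ (x v : ι → ℂ) (a b : ℂ), v ≠ 0 ∧ (a ≠ 0 ∨ b ≠ 0) ∧ A *ᵥ x = a • v ∧ B *ᵥ x = b • v ∧
      x ⬝ᵥ v = 0) ∨ B = 0 ∧ ∃ u, A = vecMulVec u u := by
  by_cases h : ∀ x ∈ LinearMap.ker B.mulVecLin, x ⬝ᵥ A *ᵥ x = 0 → A *ᵥ x = 0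
  swap
  · push Not at h
    obtain ⟨x, hBx, hx, hAx⟩ := h
    exact Or.inl ⟨x, A *ᵥ x, 1, 0, hAx, Or.inl one_ne_zero, (one_smul _ _).symm,
      by rw [zero_smul]; exact hBx, hx⟩
  obtain ⟨y, hyB, hy, hyA⟩ := exists_sub_vecMulVec_mulVec_eq_zero hA _ h
  by_cases hB0 : B = 0
  · refine Or.inr ⟨hB0, A *ᵥ y, sub_eq_zero.mp (Matrix.mulVec_injective ?_)⟩
    funext z
    rw [hyA z (by simp [hB0]), zero_mulVec]
  replace hyB : B *ᵥ y = 0 := hyB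
  left
  set A' := A - vecMulVec (A *ᵥ y) (A *ᵥ y) with hA'
  obtain ⟨x, a, hBx, hAx⟩ := exists_mulVec_eq_smul_mulVec (A := A')
    (by rw [hA', transpose_sub, transpose_vecMulVec, hA]) hB hB0 hyA
  have key : ∃ x', B *ᵥ x' = B *ᵥ x ∧ A *ᵥ x' = A' *ᵥ x := by
    refine ⟨x - ((A *ᵥ y) ⬝ᵥ x) • y, by rw [mulVec_sub, mulVec_smul, hyB]; simp, ?_⟩
    ext j
    simp [hA', mulVec_sub, sub_mulVec, mulVec_smul, vecMulVec_mulVec]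
  obtain ⟨x', hBx', hAx'⟩ := key
  refine ⟨x', B *ᵥ x, a, 1, hBx, Or.inr one_ne_zero, by rw [hAx', hAx],
    by rw [hBx', one_smul], ?_⟩
  have := dotProduct_mulVec_comm_of_isSkew hB x' x'
  rw [← hBx']
  linear_combination this / 2

theorem exists_decomposition_of_finite_rank_gt (r : ℕ) (hA : Aᵀ = A) (hB : Bᵀ = -B)
    (hfin : {μ : ℂ | r < (A + μ • B).rank}.Finite) :
    ∃ (v c d : Fin (r / 2) → ι → ℂ) (u : ι → ℂ), (Even r → u = 0) ∧
      A = vecMulVec u u + ∑ j, (vecMulVec (v j) (c j) + vecMulVec (c j) (v j)) ∧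
      B = ∑ j, (vecMulVec (v j) (d j) - vecMulVec (d j) (v j)) := by
  induction r using Nat.strong_induction_on generalizing A B with
  | _ r ih =>
  rcases exists_deflating_vector_or_eq_vecMulVec hA hB with
    ⟨x, v, a, b, hv, hab, hAx, hBx, hxv⟩ | ⟨rfl, u, rfl⟩
  · obtain ⟨c, d, hcd⟩ := exists_deflation hA hB hv hAx hBx hxv
    have hroots : {μ : ℂ | a + μ * b = 0 ∨ a - μ * b = 0}.Finite := by
      rcases eq_or_ne b 0 with rfl | hb
      · refine Set.finite_empty.subset fun μ hμ => ?_
        simp_all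
      · refine (Set.toFinite {-a / b, a / b}).subset ?_
        rintro μ (h | h)
        · left
          rw [eq_div_iff hb]
          linear_combination h
        · right
          rw [Set.mem_singleton_iff, eq_div_iff hb]
          linear_combination -h
    obtain ⟨μ, hμ⟩ := (hfin.union hroots).exists_notMem
    simp only [Set.mem_union, Set.mem_ofPred_eq, not_or, not_lt] at hμ
    have hr := hcd μ hμ.2.1 hμ.2.2
    obtain ⟨k, rfl⟩ : ∃ k, r = k + 2 := ⟨r - 2, by omega⟩
    obtain ⟨v', c', d', u, hu, hA', hB'⟩ := ih k (by omega)
      (A := A - (vecMulVec v c + vecMulVec c v)) (B := B - (vecMulVec v d - vecMulVec d v))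
      (by simp only [transpose_sub, transpose_add, transpose_vecMulVec, hA, add_comm])
      (by simp only [transpose_sub, transpose_vecMulVec, hB]; abel)
      ((hfin.union hroots).subset fun μ hμ => by
        by_contra hcon
        simp only [Set.mem_union, Set.mem_ofPred_eq, not_or, not_lt] at hcon hμ
        have := hcd μ hcon.2.1 hcon.2.2
        omega)
    rw [Nat.add_div_right k two_pos]
    refine ⟨Fin.cons v v', Fin.cons c c', Fin.cons d d', u,
      fun h => hu (by simpa [Nat.even_add] using h), ?_, ?_⟩
    · simp only [Fin.sum_univ_succ, Fin.cons_zero, Fin.cons_succ]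
      rw [add_left_comm, ← hA']
      abel
    · simp only [Fin.sum_univ_succ, Fin.cons_zero, Fin.cons_succ]
      rw [← hB']
      abel
  · rcases Nat.even_or_odd r with hr | hr
    swap
    · exact ⟨0, 0, 0, u, fun h => absurd hr (Nat.not_odd_iff_even.mpr h), by simp, by simp⟩
    rcases Nat.eq_zero_or_pos r with rfl | hpos
    · obtain ⟨μ, hμ⟩ := hfin.exists_notMem
      have h0 : vecMulVec u u = 0 := by
        have hrank : (vecMulVec u u).rank = 0 := by simpa using hμ
        rw [Matrix.rank, Submodule.finrank_eq_zero, LinearMap.range_eq_bot] at hrank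
        refine Matrix.mulVec_injective (funext fun z => ?_)
        rw [zero_mulVec]
        exact LinearMap.congr_fun hrank z
      exact ⟨0, 0, 0, 0, fun _ => rfl, by simp [h0], by simp⟩
    · have hpos' : 0 < r / 2 := by
        obtain ⟨k, rfl⟩ := hr
        omega
      refine ⟨Pi.single ⟨0, hpos'⟩ u, Pi.single ⟨0, hpos'⟩ ((1 / 2 : ℂ) • u), 0, 0,
        fun _ => rfl, ?_, by simp⟩
      rw [Finset.sum_eq_single ⟨0, hpos'⟩]
      · ext i j
        simp [vecMulVec_apply]
        ring
      · intro j _ hj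
        simp [Pi.single_eq_of_ne hj]
      · simp

end Pencil

/-- **Rank-1 decomposition for ⊤-even pencils.**
If `E(λ) = A + λB` is an `n × n` ⊤-even matrix pencil (`Aᵀ = A`, `Bᵀ = -B`) of rank
`r ≤ n`, and `s = ⌊r/2⌋`, then there exist vectors `v_j ∈ ℂ^n`, vector pencils
`w_j(λ) = c_j + λ d_j` of degree at most one, and (if `r` is odd) a vector `u ∈ ℂ^n`,
such that `A + λB = Σ (v_j w_j(λ)ᵀ + w_j(−λ) v_jᵀ)` if `r` is even, and
`A + λB = u uᵀ + Σ (v_j w_j(λ)ᵀ + w_j(−λ) v_jᵀ)` if `r` is odd. -/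
theorem top_even_rank_one_decomposition
    (n r : ℕ) (hrn : r ≤ n) (A B : Matrix (Fin n) (Fin n) ℂ)
    (hA : Aᵀ = A) (hB : Bᵀ = -B)
    (hrank : PencilRankEq n A B r) :
    ∃ (v c d : Fin (r / 2) → Fin n → ℂ) (u : Fin n → ℂ),
      (Even r → ∀ lam : ℂ,
        A + lam • B =
          ∑ j : Fin (r / 2),
            (vecMulVec (v j) (c j + lam • d j)
              + vecMulVec (c j - lam • d j) (v j))) ∧
      (Odd r → ∀ lam : ℂ,
        A + lam • B =
          vecMulVec u u +
          ∑ j : Fin (r / 2),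
            (vecMulVec (v j) (c j + lam • d j)
              + vecMulVec (c j - lam • d j) (v j))) := by
  obtain ⟨v, c, d, u, hu, hAe, hBe⟩ :=
    exists_decomposition_of_finite_rank_gt r hA hB
      (Set.finite_empty.subset fun μ hμ => absurd hμ (not_lt.mpr (hrank.2 μ)))
  have key (lam : ℂ) : A + lam • B = vecMulVec u u + ∑ j : Fin (r / 2),
      (vecMulVec (v j) (c j + lam • d j) + vecMulVec (c j - lam • d j) (v j)) := by
    rw [hAe, hBe, add_assoc, Finset.smul_sum, ← Finset.sum_add_distrib]
    congr 1
    refine Finset.sum_congr rfl fun j _ => ?_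
    rw [vecMulVec_add, sub_vecMulVec, vecMulVec_smul, smul_vecMulVec, smul_sub]
    abel
  refine ⟨v, c, d, u, fun hr lam => ?_, fun _ lam => key lam⟩
  rw [key, hu hr, zero_vecMulVec, zero_add]
end

section
/- Let E(λ)=A+λB be an n×n ⊤-odd matrix pencil over ℂ (i.e., A^T=−A, B^T=B) whose rank equals r (r ≤ n), and set s=⌊r/2⌋. Then there exist vectors v_1,…,v_s ∈ ℂ^n, vector pencils w_1,…,w_s of degree at most one, and (if r is odd) a vector u ∈ ℂ^n, such that A+λB = Σ_{j=1}^{s} ( v_j w_j(λ)^T − w_j(−λ) v_j^T ) if r is even, and A+λB = λ u u^T + Σ_{j=1}^{s} ( v_j w_j(λ)^T − w_j(−λ) v_j^T ) if r is odd. -/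
open Matrix BigOperators

open Module Filter

section BilinearForms

variable {V : Type*} [AddCommGroup V] [Module ℂ V]

/-- If `x` is orthogonal to the hyperplane `ker ψ` on both sides but not to all of `V`, and lies in
that hyperplane, then restricting a bilinear form to the hyperplane lowers its rank by two. -/
theorem finrank_range_domRestrict_ker_add_two_le [FiniteDimensional ℂ V]
    (M : V →ₗ[ℂ] V →ₗ[ℂ] ℂ) {x : V} {ψ : V →ₗ[ℂ] ℂ} {p q : ℂ} (hp : p ≠ 0) (hq : q ≠ 0)
    (hψ : ψ ≠ 0) (hψx : ψ x = 0) (hMx : M x = p • ψ) (hxM : ∀ y, M y x = q * ψ y) :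
    finrank ℂ (LinearMap.range (M.domRestrict₁₂ (LinearMap.ker ψ) (LinearMap.ker ψ))) + 2 ≤
      finrank ℂ (LinearMap.range M) := by
  set H := LinearMap.ker ψ
  obtain ⟨z, hz⟩ : ∃ z, ψ z ≠ 0 := by
    by_contra! h
    exact hψ (LinearMap.ext h)
  have hlt : H.map M < LinearMap.range M := by
    refine lt_of_le_of_ne (LinearMap.map_le_range) fun h => ?_
    have hmem : M z ∈ H.map M := h ▸ LinearMap.mem_range_self M z
    obtain ⟨y, hy, hyz⟩ := hmem
    have h1 := hxM z
    rw [← hyz, hxM y, show ψ y = 0 from hy, mul_zero] at h1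
    exact mul_ne_zero hq hz h1.symm
  let ρ : (V →ₗ[ℂ] ℂ) →ₗ[ℂ] (H →ₗ[ℂ] ℂ) := H.subtype.dualMap
  have hrange : LinearMap.range (M.domRestrict₁₂ H H) = LinearMap.range (ρ.domRestrict (H.map M)) := by
    ext f
    constructor
    · rintro ⟨y, rfl⟩
      exact ⟨⟨M y, Submodule.mem_map_of_mem y.2⟩, rfl⟩
    · rintro ⟨⟨_, y, hy, rfl⟩, rfl⟩
      exact ⟨⟨y, hy⟩, rfl⟩
  have hker : 0 < finrank ℂ (LinearMap.ker (ρ.domRestrict (H.map M))) := by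
    have hmem : M x ∈ H.map M := ⟨x, hψx, rfl⟩
    refine (Module.finrank_pos_iff_exists_ne_zero (R := ℂ)).2
      ⟨(⟨⟨M x, hmem⟩, ?_⟩ : LinearMap.ker (ρ.domRestrict (H.map M))), fun h => ?_⟩
    · rw [LinearMap.mem_ker]
      ext y
      change M x y = 0
      rw [hMx, LinearMap.smul_apply, show ψ y = 0 from y.2, smul_zero]
    · have h0 : M x = 0 := congrArg (fun t => (t.1.1 : V →ₗ[ℂ] ℂ)) h
      rw [hMx] at h0
      exact smul_ne_zero hp hψ h0
  have h1 := Submodule.finrank_lt_finrank_of_lt hlt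
  have h2 := LinearMap.finrank_range_add_finrank_ker (ρ.domRestrict (H.map M))
  rw [hrange]
  omega

/-- The rank of a bilinear form does not grow under restriction to a subspace. -/
theorem finrank_range_domRestrict_le [FiniteDimensional ℂ V]
    (M : V →ₗ[ℂ] V →ₗ[ℂ] ℂ) (U : Submodule ℂ V) :
    finrank ℂ (LinearMap.range (M.domRestrict₁₂ U U)) ≤ finrank ℂ (LinearMap.range M) := by
  let ρ : (V →ₗ[ℂ] ℂ) →ₗ[ℂ] (U →ₗ[ℂ] ℂ) := U.subtype.dualMap
  have hle : LinearMap.range (M.domRestrict₁₂ U U) ≤ (LinearMap.range M).map ρ := by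
    rintro _ ⟨y, rfl⟩
    exact ⟨M y, ⟨y, rfl⟩, rfl⟩
  exact (Submodule.finrank_mono hle).trans (Submodule.finrank_map_le ρ _)

/-- A symmetric form `B` and an alternating form `A` on a space of dimension at least two admit a
nonzero `B`-isotropic vector at which the functionals `A x` and `B x` are proportional. -/
theorem exists_isotropic_eigenvector [FiniteDimensional ℂ V]
    (A B : V →ₗ[ℂ] V →ₗ[ℂ] ℂ) (hA : ∀ x y, A x y = -A y x) (hB : ∀ x y, B x y = B y x)
    (hV : 2 ≤ finrank ℂ V) :
    ∃ x ≠ 0, B x x = 0 ∧ (B x = 0 ∨ ∃ c : ℂ, A x = c • B x) := by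
  have hAxx : ∀ x, A x x = 0 := fun x => self_eq_neg.1 (hA x x)
  by_cases hinj : ∃ x ≠ 0, B x = 0
  · obtain ⟨x, hx, hBx⟩ := hinj
    exact ⟨x, hx, by simp [hBx], Or.inl hBx⟩
  push Not at hinj
  have hBinj : Function.Injective B := by
    rw [← LinearMap.ker_eq_bot, LinearMap.ker_eq_bot']
    intro x hx
    by_contra h
    exact hinj x h hx
  let e : V ≃ₗ[ℂ] (V →ₗ[ℂ] ℂ) :=
    LinearMap.linearEquivOfInjective B hBinj Subspace.dual_finrank_eq.symm
  let S : End ℂ V := e.symm.toLinearMap ∘ₗ A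
  have hS : ∀ x, B (S x) = A x := fun x => e.apply_symm_apply (A x)
  have heig : ∀ (x : V) (c : ℂ), S x = c • x → A x = c • B x := fun x c h => by rw [← hS, h, map_smul]
  have hiso : ∀ (x : V) (c : ℂ), S x = c • x → c ≠ 0 → B x x = 0 := fun x c h hc => by
    have h1 := hAxx x
    rw [heig x c h, LinearMap.smul_apply, smul_eq_mul] at h1
    exact (mul_eq_zero.1 h1).resolve_left hc
  have : Nontrivial V := nontrivial_of_finrank_pos (R := ℂ) (by omega)
  obtain ⟨c₀, hc₀⟩ := Module.End.exists_eigenvalue S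
  obtain ⟨x₀, hx₀⟩ := hc₀.exists_hasEigenvector
  have hSx₀ := hx₀.apply_eq_smul
  by_cases hB₀ : B x₀ x₀ = 0
  · exact ⟨x₀, hx₀.2, hB₀, Or.inr ⟨c₀, heig x₀ c₀ hSx₀⟩⟩
  have hAx₀ : A x₀ = 0 := by
    have hc : c₀ = 0 := by
      by_contra hc
      exact hB₀ (hiso x₀ c₀ hSx₀ hc)
    rw [heig x₀ c₀ hSx₀, hc, zero_smul]
  have hH := Module.Dual.finrank_ker_add_one_of_ne_zero (hinj x₀ hx₀.2)
  have hinv : ∀ y ∈ LinearMap.ker (B x₀), S y ∈ LinearMap.ker (B x₀) := fun y _ => by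
    rw [LinearMap.mem_ker, hB, hS, hA, hAx₀, LinearMap.zero_apply, neg_zero]
  have : Nontrivial (LinearMap.ker (B x₀)) := nontrivial_of_finrank_pos (R := ℂ) (by omega)
  obtain ⟨c₁, hc₁⟩ := Module.End.exists_eigenvalue (S.restrict hinv)
  obtain ⟨⟨x₁, hx₁H⟩, hx₁⟩ := hc₁.exists_hasEigenvector
  have hSx₁ : S x₁ = c₁ • x₁ := congrArg Subtype.val hx₁.apply_eq_smul
  have hx₁0 : x₁ ≠ 0 := fun h => hx₁.2 (Subtype.ext h)
  by_cases hB₁ : B x₁ x₁ = 0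
  · exact ⟨x₁, hx₁0, hB₁, Or.inr ⟨c₁, heig x₁ c₁ hSx₁⟩⟩
  have hAx₁ : A x₁ = 0 := by
    have hc : c₁ = 0 := by
      by_contra hc
      exact hB₁ (hiso x₁ c₁ hSx₁ hc)
    rw [heig x₁ c₁ hSx₁, hc, zero_smul]
  have h01 : B x₀ x₁ = 0 := hx₁H
  obtain ⟨t, ht⟩ := IsAlgClosed.exists_pow_nat_eq (-(B x₀ x₀) / B x₁ x₁) two_pos
  refine ⟨x₀ + t • x₁, fun h => hB₀ ?_, ?_, Or.inr ⟨0, by simp [hAx₀, hAx₁]⟩⟩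
  · have h2 := congrArg (B x₀) h
    simpa [h01] using h2
  · have h10 : B x₁ x₀ = 0 := (hB x₁ x₀).trans h01
    simp only [map_add, map_smul, LinearMap.add_apply, LinearMap.smul_apply, smul_eq_mul, h01, h10]
    field_simp at ht
    linear_combination ht

/-- A skew-symmetric form `A` and a symmetric form `B` whose pencil has rank at most `r` outside a
finite set of parameters have a common totally isotropic subspace of codimension at most `r / 2`, up
to a rank-one restriction of `B` when `r` is odd. -/
theorem exists_isotropic_submodule [FiniteDimensional ℂ V]
    (A B : V →ₗ[ℂ] V →ₗ[ℂ] ℂ) (hA : ∀ x y, A x y = -A y x) (hB : ∀ x y, B x y = B y x) (r : ℕ)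
    (hr : ∀ᶠ μ : ℂ in cofinite, finrank ℂ (LinearMap.range (A + μ • B)) ≤ r) :
    ∃ W : Submodule ℂ V, finrank ℂ V ≤ finrank ℂ W + r / 2 ∧
      (∀ x ∈ W, ∀ y ∈ W, A x y = 0) ∧
      (Even r → ∀ x ∈ W, ∀ y ∈ W, B x y = 0) ∧
      ∀ x ∈ W, ∀ y ∈ W, B x x * B y y = B x y ^ 2 := by
  have hAxx : ∀ x, A x x = 0 := fun x => self_eq_neg.1 (hA x x)
  induction hn : finrank ℂ V using Nat.strong_induction_on generalizing V r with
  | _ n ih =>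
  subst hn
  rcases Nat.lt_or_ge (finrank ℂ V) 2 with hV | hV
  · by_cases hrV : finrank ℂ V ≤ r / 2
    · refine ⟨⊥, by omega, ?_, ?_, ?_⟩ <;> simp +contextual
    obtain ⟨z, -, hz⟩ := finrank_eq_one_iff'.1 (show finrank ℂ V = 1 by omega)
    have hA0 : A = 0 := by
      ext x y
      obtain ⟨a, rfl⟩ := hz x
      obtain ⟨b, rfl⟩ := hz y
      simp [hAxx]
    refine ⟨⊤, by simp, by simp [hA0], fun hev => ?_, ?_⟩
    · obtain ⟨μ, hμ, hμ0⟩ := (hr.and (eventually_cofinite_ne 0)).exists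
      have hr0 : r = 0 := by
        obtain ⟨k, hk⟩ := hev
        omega
      rw [hr0, Nat.le_zero, Submodule.finrank_eq_zero, LinearMap.range_eq_bot, hA0, zero_add,
        smul_eq_zero_iff_right hμ0] at hμ
      simp [hμ]
    · intro x _ y _
      obtain ⟨a, rfl⟩ := hz x
      obtain ⟨b, rfl⟩ := hz y
      simp only [map_smul, LinearMap.smul_apply, smul_eq_mul]
      ring
  obtain ⟨x, hx, hBxx, hdep⟩ := exists_isotropic_eigenvector A B hA hB hV
  obtain ⟨ψ, a, b, hAx, hBx, hab⟩ : ∃ (ψ : V →ₗ[ℂ] ℂ) (a b : ℂ), A x = a • ψ ∧ B x = b • ψ ∧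
      (a ≠ 0 ∨ b ≠ 0) := by
    rcases hdep with h | ⟨c, h⟩
    · exact ⟨A x, 1, 0, by simp, by simp [h], by simp⟩
    · exact ⟨B x, c, 1, h, by simp, by simp⟩
  by_cases hψ : ψ = 0
  · rw [hψ, smul_zero] at hAx hBx
    obtain ⟨U, hU⟩ := Submodule.exists_isCompl (ℂ ∙ x)
    have hdim := Submodule.finrank_add_eq_of_isCompl hU
    rw [finrank_span_singleton hx] at hdim
    obtain ⟨W, hW, hWA, hWB, hWB'⟩ := ih (finrank ℂ U) (by omega) (A.domRestrict₁₂ U U)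
      (B.domRestrict₁₂ U U) (fun y z => hA y z) (fun y z => hB y z) r
      (hr.mono fun μ hμ => (finrank_range_domRestrict_le (A + μ • B) U).trans hμ)
      (fun y => hAxx y) rfl
    have hAx' : ∀ y, A y x = 0 := fun y => by rw [hA, hAx, LinearMap.zero_apply, neg_zero]
    have hBx' : ∀ y, B y x = 0 := fun y => by rw [hB, hBx, LinearMap.zero_apply]
    have hdisj : Disjoint (W.map U.subtype) (ℂ ∙ x) :=
      hU.disjoint.symm.mono_left (Submodule.map_subtype_le U W)
    have hmem : ∀ y ∈ W.map U.subtype ⊔ (ℂ ∙ x), ∃ w : U, w ∈ W ∧ ∃ t : ℂ, y = w + t • x := by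
      intro y hy
      obtain ⟨_, ⟨w, hw, rfl⟩, _, hz, rfl⟩ := Submodule.mem_sup.1 hy
      obtain ⟨t, rfl⟩ := Submodule.mem_span_singleton.1 hz
      exact ⟨w, hw, t, rfl⟩
    refine ⟨W.map U.subtype ⊔ (ℂ ∙ x), ?_, ?_, ?_, ?_⟩
    · have h1 := Submodule.finrank_sup_add_finrank_inf_eq (W.map U.subtype) (ℂ ∙ x)
      rw [hdisj.eq_bot, finrank_bot, finrank_span_singleton hx,
        Submodule.finrank_map_subtype_eq] at h1
      omega
    · intro y hy z hz
      obtain ⟨w, hw, t, rfl⟩ := hmem y hy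
      obtain ⟨w', hw', t', rfl⟩ := hmem z hz
      simpa [hAx, hAx'] using show A w w' = 0 from hWA w hw w' hw'
    · intro hev y hy z hz
      obtain ⟨w, hw, t, rfl⟩ := hmem y hy
      obtain ⟨w', hw', t', rfl⟩ := hmem z hz
      simpa [hBx, hBx'] using show B w w' = 0 from hWB hev w hw w' hw'
    · intro y hy z hz
      obtain ⟨w, hw, t, rfl⟩ := hmem y hy
      obtain ⟨w', hw', t', rfl⟩ := hmem z hz
      simpa [hBx, hBx'] using
        show B w w * B w' w' = B w w' ^ 2 from hWB' w hw w' hw'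
  · have hψx : ψ x = 0 := by
      rcases hab with h | h
      · have h1 := hAxx x
        rw [hAx, LinearMap.smul_apply, smul_eq_mul] at h1
        exact (mul_eq_zero.1 h1).resolve_left h
      · rw [hBx, LinearMap.smul_apply, smul_eq_mul] at hBxx
        exact (mul_eq_zero.1 hBxx).resolve_left h
    have hgen : ∀ᶠ μ : ℂ in cofinite, a + μ * b ≠ 0 ∧ -a + μ * b ≠ 0 := by
      by_cases hb : b = 0
      · exact Eventually.of_forall fun μ => by simpa [hb] using hab
      filter_upwards [eventually_cofinite_ne (-a / b), eventually_cofinite_ne (a / b)] with μ h₁ h₂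
      refine ⟨fun h => h₁ ?_, fun h => h₂ ?_⟩ <;> rw [eq_div_iff hb] <;> linear_combination h
    have hdrop : ∀ᶠ μ : ℂ in cofinite, finrank ℂ (LinearMap.range
        ((A + μ • B).domRestrict₁₂ (LinearMap.ker ψ) (LinearMap.ker ψ))) + 2 ≤ r := by
      filter_upwards [hr, hgen] with μ hμ h
      refine (finrank_range_domRestrict_ker_add_two_le (A + μ • B) h.1 h.2 hψ hψx ?_ ?_).trans hμ
      · rw [LinearMap.add_apply, LinearMap.smul_apply, hAx, hBx, smul_smul, ← add_smul]
      · intro y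
        rw [LinearMap.add_apply, LinearMap.smul_apply, LinearMap.add_apply, LinearMap.smul_apply,
          hA, hB, hAx, hBx]
        simp only [LinearMap.smul_apply, smul_eq_mul]
        ring
    obtain ⟨μ₀, hμ₀⟩ := hdrop.exists
    have hdim := Module.Dual.finrank_ker_add_one_of_ne_zero hψ
    obtain ⟨W, hW, hWA, hWB, hWB'⟩ := ih (finrank ℂ (LinearMap.ker ψ)) (by omega)
      (A.domRestrict₁₂ (LinearMap.ker ψ) (LinearMap.ker ψ))
      (B.domRestrict₁₂ (LinearMap.ker ψ) (LinearMap.ker ψ))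
      (fun y z => hA y z) (fun y z => hB y z) (r - 2)
      (hdrop.mono fun μ hμ => Nat.le_sub_of_add_le hμ) (fun y => hAxx y) rfl
    refine ⟨W.map (LinearMap.ker ψ).subtype, ?_, ?_, ?_, ?_⟩
    · rw [Submodule.finrank_map_subtype_eq]
      omega
    · rintro _ ⟨y, hy, rfl⟩ _ ⟨z, hz, rfl⟩
      exact hWA y hy z hz
    · rintro hev _ ⟨y, hy, rfl⟩ _ ⟨z, hz, rfl⟩
      exact hWB ((Nat.even_sub (by omega)).2 (by simp [hev])) y hy z hz
    · rintro _ ⟨y, hy, rfl⟩ _ ⟨z, hz, rfl⟩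
      exact hWB' y hy z hz

/-- A symmetric form whose two-by-two Gram determinants vanish on `W` is the square of a linear
functional on `W`. -/
theorem exists_eq_mul_of_gram_eq_zero (B : V →ₗ[ℂ] V →ₗ[ℂ] ℂ) (hB : ∀ x y, B x y = B y x)
    (W : Submodule ℂ V) (hW : ∀ x ∈ W, ∀ y ∈ W, B x x * B y y = B x y ^ 2) :
    ∃ φ : V →ₗ[ℂ] ℂ, ∀ x ∈ W, ∀ y ∈ W, B x y = φ x * φ y := by
  by_cases h : ∀ x ∈ W, B x x = 0
  · refine ⟨0, fun x hx y hy => ?_⟩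
    have h1 := hW x hx y hy
    rw [h x hx, zero_mul] at h1
    simpa using h1.symm
  push Not at h
  obtain ⟨z, hz, hzz⟩ := h
  obtain ⟨t, ht⟩ := IsAlgClosed.exists_pow_nat_eq (B z z) two_pos
  have ht0 : t ≠ 0 := by
    rintro rfl
    exact hzz (by rw [← ht]; simp)
  refine ⟨t⁻¹ • B z, fun x hx y hy => ?_⟩
  have h1 := hW z hz (x + y) (W.add_mem hx hy)
  have h2 := hW z hz x hx
  have h3 := hW z hz y hy
  simp only [map_add, LinearMap.add_apply] at h1
  rw [hB y x] at h1
  simp only [LinearMap.smul_apply, smul_eq_mul]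
  field_simp
  rw [ht]
  linear_combination (h1 - h2 - h3) / 2

/-- A subspace of codimension at most `s` is cut out by `s` functionals, together with vectors whose
combinations correct any vector into the subspace. -/
theorem exists_sub_sum_smul_mem [FiniteDimensional ℂ V] (W : Submodule ℂ V) (s : ℕ)
    (hs : finrank ℂ V ≤ finrank ℂ W + s) :
    ∃ (v : Fin s → V →ₗ[ℂ] ℂ) (e : Fin s → V), ∀ y, y - ∑ j, v j y • e j ∈ W := by
  have hq := W.finrank_quotient_add_finrank
  obtain ⟨i, hi⟩ := (finrank_le_iff_exists_linearMap (R := ℂ) (M := V ⧸ W) (M' := Fin s → ℂ)).1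
    (by rw [finrank_fin_fun]; omega)
  obtain ⟨l, hl⟩ := i.exists_leftInverse_of_injective (LinearMap.ker_eq_bot.2 hi)
  obtain ⟨σ, hσ⟩ := W.mkQ.exists_rightInverse_of_surjective W.range_mkQ
  refine ⟨fun j => LinearMap.proj j ∘ₗ i ∘ₗ W.mkQ, fun j => σ (l (Pi.single j 1)), fun y => ?_⟩
  rw [← Submodule.Quotient.mk_eq_zero, ← Submodule.mkQ_apply, map_sub, sub_eq_zero, map_sum]
  have hσ' : ∀ q, W.mkQ (σ q) = q := LinearMap.congr_fun hσ
  have hl' : ∀ q, l (i q) = q := LinearMap.congr_fun hl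
  simp only [map_smul, hσ', LinearMap.comp_apply, LinearMap.proj_apply]
  conv_lhs => rw [← hl' (W.mkQ y), pi_eq_sum_univ' (i (W.mkQ y)), map_sum]
  refine Finset.sum_congr rfl fun j _ => ?_
  rw [map_smul]

/-- For `P = ∑ j, v j • e j`, a skew-symmetric and a symmetric form differ from their pullbacks along
`1 - P` by sums of elementary forms whose first factors are the functionals `v j`. -/
theorem exists_eq_apply_sub_add_sum (A B : V →ₗ[ℂ] V →ₗ[ℂ] ℂ) (hA : ∀ x y, A x y = -A y x)
    (hB : ∀ x y, B x y = B y x) {s : ℕ} (v : Fin s → V →ₗ[ℂ] ℂ) (e : Fin s → V)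
    (P : V →ₗ[ℂ] V) (hP : ∀ y, P y = ∑ j, v j y • e j) :
    ∃ c d : Fin s → V →ₗ[ℂ] ℂ, ∀ x y,
      A x y = A (x - P x) (y - P y) + ∑ j, (v j x * c j y - c j x * v j y) ∧
      B x y = B (x - P x) (y - P y) + ∑ j, (v j x * d j y + d j x * v j y) := by
  have hsum : ∀ (M : V →ₗ[ℂ] V →ₗ[ℂ] ℂ) x y,
      ∑ j, v j x * (M (e j) y - (1 / 2) * M (e j) (P y)) =
        M (P x) y - (1 / 2) * M (P x) (P y) := by
    intro M x y
    simp only [hP x, map_sum, map_smul, LinearMap.sum_apply, LinearMap.smul_apply, smul_eq_mul,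
      Finset.mul_sum, ← Finset.sum_sub_distrib]
    exact Finset.sum_congr rfl fun j _ => by ring
  refine ⟨fun j => A (e j) - (1 / 2 : ℂ) • (A (e j) ∘ₗ P),
    fun j => B (e j) - (1 / 2 : ℂ) • (B (e j) ∘ₗ P), fun x y => ⟨?_, ?_⟩⟩
  · have h1 := hsum A x y
    have h2 := hsum A y x
    simp only [LinearMap.sub_apply, LinearMap.smul_apply, LinearMap.comp_apply, smul_eq_mul,
      Finset.sum_sub_distrib, map_sub, mul_comm _ (v _ y)]
    rw [h1, h2, hA (P y) x, hA (P y) (P x)]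
    ring
  · have h1 := hsum B x y
    have h2 := hsum B y x
    simp only [LinearMap.sub_apply, LinearMap.smul_apply, LinearMap.comp_apply, smul_eq_mul,
      Finset.sum_add_distrib, map_sub, mul_comm _ (v _ y)]
    rw [h1, h2, hB (P y) x, hB (P y) (P x)]
    ring

/-- A skew-symmetric form `A` and a symmetric form `B` whose pencil has rank at most `r` outside a
finite set of parameters are sums of `r / 2` elementary skew-symmetric, respectively symmetric, forms
with common left factors, up to one square of a functional in `B` when `r` is odd. -/
theorem exists_rank_one_decomposition [FiniteDimensional ℂ V]
    (A B : V →ₗ[ℂ] V →ₗ[ℂ] ℂ) (hA : ∀ x y, A x y = -A y x) (hB : ∀ x y, B x y = B y x) (r : ℕ)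
    (hr : ∀ᶠ μ : ℂ in cofinite, finrank ℂ (LinearMap.range (A + μ • B)) ≤ r) :
    ∃ (v c d : Fin (r / 2) → V →ₗ[ℂ] ℂ) (u : V →ₗ[ℂ] ℂ), ∀ x y,
      A x y = ∑ j, (v j x * c j y - c j x * v j y) ∧
      (Even r → B x y = ∑ j, (v j x * d j y + d j x * v j y)) ∧
      B x y = u x * u y + ∑ j, (v j x * d j y + d j x * v j y) := by
  obtain ⟨W, hW, hWA, hWB, hWB'⟩ := exists_isotropic_submodule A B hA hB r hr
  obtain ⟨φ, hφ⟩ := exists_eq_mul_of_gram_eq_zero B hB W hWB'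
  obtain ⟨v, e, hve⟩ := exists_sub_sum_smul_mem W (r / 2) hW
  let P : V →ₗ[ℂ] V := ∑ j, (v j).smulRight (e j)
  have hP : ∀ y, P y = ∑ j, v j y • e j := fun y => by simp [P]
  have hPW : ∀ y, y - P y ∈ W := fun y => hP y ▸ hve y
  obtain ⟨c, d, hcd⟩ := exists_eq_apply_sub_add_sum A B hA hB v e P hP
  refine ⟨v, c, d, φ ∘ₗ (LinearMap.id - P), fun x y => ⟨?_, fun hev => ?_, ?_⟩⟩
  · rw [(hcd x y).1, hWA _ (hPW x) _ (hPW y), zero_add]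
  · rw [(hcd x y).2, hWB hev _ (hPW x) _ (hPW y), zero_add]
  · rw [(hcd x y).2, hφ _ (hPW x) _ (hPW y)]
    rfl

end BilinearForms

/-- The rank of the bilinear form of a square matrix is at most the rank of the matrix. -/
theorem finrank_range_toLinearMap₂'_le {n : ℕ} (M : Matrix (Fin n) (Fin n) ℂ) :
    finrank ℂ (LinearMap.range
      (Matrix.toLinearMap₂' ℂ M : (Fin n → ℂ) →ₗ[ℂ] (Fin n → ℂ) →ₗ[ℂ] ℂ)) ≤ M.rank := by
  have hM : (Matrix.toLinearMap₂' ℂ M : (Fin n → ℂ) →ₗ[ℂ] (Fin n → ℂ) →ₗ[ℂ] ℂ) =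
      (Matrix.toLinearMap₂' ℂ (1 : Matrix (Fin n) (Fin n) ℂ) :
        (Fin n → ℂ) →ₗ[ℂ] (Fin n → ℂ) →ₗ[ℂ] ℂ) ∘ₗ Mᵀ.mulVecLin := by
    refine LinearMap.ext fun x => LinearMap.ext fun y => ?_
    rw [LinearMap.comp_apply, Matrix.toLinearMap₂'_apply', Matrix.toLinearMap₂'_apply',
      Matrix.one_mulVec, Matrix.mulVecLin_apply, Matrix.mulVec_transpose,
      Matrix.dotProduct_mulVec]
  rw [hM, LinearMap.range_comp, ← Matrix.rank_transpose M]
  exact Submodule.finrank_map_le _ _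

/-- **Rank-1 decomposition for ⊤-odd pencils.**
If `E(λ) = A + λB` is an `n × n` ⊤-odd matrix pencil (`Aᵀ = -A`, `Bᵀ = B`) of rank
`r ≤ n`, and `s = ⌊r/2⌋`, then there exist vectors `v_j ∈ ℂ^n`, vector pencils
`w_j(λ) = c_j + λ d_j` of degree at most one, and (if `r` is odd) a vector `u ∈ ℂ^n`,
such that `A + λB = Σ (v_j w_j(λ)ᵀ − w_j(−λ) v_jᵀ)` if `r` is even, and
`A + λB = λ u uᵀ + Σ (v_j w_j(λ)ᵀ − w_j(−λ) v_jᵀ)` if `r` is odd. -/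
theorem top_odd_rank_one_decomposition
    (n r : ℕ) (hrn : r ≤ n) (A B : Matrix (Fin n) (Fin n) ℂ)
    (hA : Aᵀ = -A) (hB : Bᵀ = B)
    (hrank : PencilRankEq n A B r) :
    ∃ (v c d : Fin (r / 2) → Fin n → ℂ) (u : Fin n → ℂ),
      (Even r → ∀ lam : ℂ,
        A + lam • B =
          ∑ j : Fin (r / 2),
            (vecMulVec (v j) (c j + lam • d j)
              - vecMulVec (c j - lam • d j) (v j))) ∧
      (Odd r → ∀ lam : ℂ,
        A + lam • B =
          lam • vecMulVec u u +
          ∑ j : Fin (r / 2),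
            (vecMulVec (v j) (c j + lam • d j)
              - vecMulVec (c j - lam • d j) (v j))) := by
  have hA' : ∀ i j, A i j = -A j i := fun i j => congrFun (congrFun hA j) i
  have hB' : ∀ i j, B i j = B j i := fun i j => congrFun (congrFun hB j) i
  let F : (Fin n → ℂ) →ₗ[ℂ] (Fin n → ℂ) →ₗ[ℂ] ℂ := Matrix.toLinearMap₂' ℂ A
  let G : (Fin n → ℂ) →ₗ[ℂ] (Fin n → ℂ) →ₗ[ℂ] ℂ := Matrix.toLinearMap₂' ℂ B
  have hF : ∀ x y, F x y = -F y x := fun x y => by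
    simp only [F, Matrix.toLinearMap₂'_apply, smul_eq_mul]
    rw [Finset.sum_comm, ← Finset.sum_neg_distrib]
    refine Finset.sum_congr rfl fun i _ => ?_
    rw [← Finset.sum_neg_distrib]
    refine Finset.sum_congr rfl fun j _ => ?_
    rw [hA' j i]
    ring
  have hG : ∀ x y, G x y = G y x := fun x y => by
    simp only [G, Matrix.toLinearMap₂'_apply, smul_eq_mul]
    rw [Finset.sum_comm]
    refine Finset.sum_congr rfl fun i _ => Finset.sum_congr rfl fun j _ => ?_
    rw [hB' j i]
    ring
  have hFG : ∀ μ : ℂ, Matrix.toLinearMap₂' ℂ (A + μ • B) = F + μ • G := fun μ =>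
    ((Matrix.toLinearMap₂' ℂ).map_add A (μ • B)).trans
      (congrArg (F + ·) ((Matrix.toLinearMap₂' ℂ).map_smul μ B))
  obtain ⟨v, c, d, u, h⟩ := exists_rank_one_decomposition F G hF hG r
    (Eventually.of_forall fun μ =>
      hFG μ ▸ (finrank_range_toLinearMap₂'_le (A + μ • B)).trans (hrank.2 μ))
  let toVec : ((Fin n → ℂ) →ₗ[ℂ] ℂ) → Fin n → ℂ := fun f i => f (Pi.single i 1)
  have hFA : ∀ i j, F (Pi.single i 1) (Pi.single j 1) = A i j :=
    fun i j => by simp [F, Matrix.toLinearMap₂'_apply']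
  have hGB : ∀ i j, G (Pi.single i 1) (Pi.single j 1) = B i j :=
    fun i j => by simp [G, Matrix.toLinearMap₂'_apply']
  refine ⟨fun j => toVec (v j), fun j => toVec (c j), fun j => toVec (d j),
    toVec u, fun hev lam => ?_, fun _ lam => ?_⟩
  · ext i k
    obtain ⟨h₁, h₂, -⟩ := h (Pi.single i 1) (Pi.single k 1)
    rw [hFA] at h₁
    rw [hGB] at h₂
    simp only [Matrix.add_apply, Matrix.smul_apply, Matrix.sum_apply, Matrix.sub_apply,
      vecMulVec_apply, Pi.add_apply, Pi.sub_apply, Pi.smul_apply, smul_eq_mul, toVec, h₁, h₂ hev,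
      Finset.mul_sum, ← Finset.sum_add_distrib]
    exact Finset.sum_congr rfl fun j _ => by ring
  · ext i k
    obtain ⟨h₁, -, h₂⟩ := h (Pi.single i 1) (Pi.single k 1)
    rw [hFA] at h₁
    rw [hGB] at h₂
    simp only [Matrix.add_apply, Matrix.smul_apply, Matrix.sum_apply, Matrix.sub_apply,
      vecMulVec_apply, Pi.add_apply, Pi.sub_apply, Pi.smul_apply, smul_eq_mul, toVec, h₁, h₂,
      mul_add, Finset.mul_sum]
    rw [add_left_comm, ← Finset.sum_add_distrib]
    congr 1
    exact Finset.sum_congr rfl fun j _ => by ring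
end

section
/- Let E(λ)=A+λB be an n×n ⊤-anti-palindromic matrix pencil over ℂ (i.e., A^T=−B) whose rank equals r (r ≤ n), and set s=⌊r/2⌋. Then there exist vectors v_1,…,v_s ∈ ℂ^n, vector pencils w_1,…,w_s of degree at most one, and (if r is odd) a vector u ∈ ℂ^n, such that A+λB = Σ_{j=1}^{s} ( v_j w_j(λ)^T − (rev w_j)(λ) v_j^T ) if r is even, and A+λB = (1−λ) u u^T + Σ_{j=1}^{s} ( v_j w_j(λ)^T − (rev w_j)(λ) v_j^T ) if r is odd. -/
open Matrix BigOperators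

open Module

/-- A bilinear form `A` has an `r`-decomposition if it is a sum of `⌊r/2⌋` forms
`v ⊗ c + d ⊗ v` and, when `r` is odd, one form `u ⊗ u`. -/
def HasRankDecomposition {V : Type*} [AddCommGroup V] [Module ℂ V]
    (A : V →ₗ[ℂ] V →ₗ[ℂ] ℂ) (r : ℕ) : Prop :=
  ∃ (v c d : Fin (r / 2) → Dual ℂ V) (u : Dual ℂ V), (Even r → u = 0) ∧
    ∀ x y, A x y = u x * u y + ∑ j, (v j x * c j y + d j x * v j y)

section

variable {V : Type*} [AddCommGroup V] [Module ℂ V] {A A' : V →ₗ[ℂ] V →ₗ[ℂ] ℂ} {r : ℕ}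

theorem HasRankDecomposition.add_term (h : HasRankDecomposition A' r) (v c d : Dual ℂ V)
    (hA : ∀ x y, A x y = A' x y + (v x * c y + d x * v y)) :
    HasRankDecomposition A (r + 2) := by
  obtain ⟨v', c', d', u, hu, h⟩ := h
  have e : (r + 2) / 2 = r / 2 + 1 := by omega
  unfold HasRankDecomposition
  rw [e]
  refine ⟨Fin.cons v v', Fin.cons c c', Fin.cons d d', u, fun hr => hu ?_, fun x y => ?_⟩
  · simpa [Nat.even_add] using hr
  · rw [hA, h, Fin.sum_univ_succ]
    simp only [Fin.cons_zero, Fin.cons_succ]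
    ring

theorem HasRankDecomposition.add_square (h : HasRankDecomposition A' r) (hr : Even r)
    (u : Dual ℂ V) (hA : ∀ x y, A x y = A' x y + u x * u y) :
    HasRankDecomposition A (r + 1) := by
  obtain ⟨v', c', d', u', hu, h⟩ := h
  have e : (r + 1) / 2 = r / 2 := by
    obtain ⟨k, rfl⟩ := hr
    omega
  unfold HasRankDecomposition
  rw [e]
  refine ⟨v', c', d', u, fun hr' => absurd hr (by simpa [Nat.even_add_one] using hr'),
    fun x y => ?_⟩
  rw [hA, h, hu hr]
  simp only [LinearMap.zero_apply]
  ring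

theorem HasRankDecomposition.comp {W : Type*} [AddCommGroup W] [Module ℂ W]
    {B : W →ₗ[ℂ] W →ₗ[ℂ] ℂ} (h : HasRankDecomposition B r) (p : V →ₗ[ℂ] W)
    (hA : ∀ x y, A x y = B (p x) (p y)) : HasRankDecomposition A r := by
  obtain ⟨v, c, d, u, hu, h⟩ := h
  refine ⟨fun j => v j ∘ₗ p, fun j => c j ∘ₗ p, fun j => d j ∘ₗ p, u ∘ₗ p,
    fun hr => by simp [hu hr], fun x y => ?_⟩
  simp [hA, h]

theorem HasRankDecomposition.zero : HasRankDecomposition (0 : V →ₗ[ℂ] V →ₗ[ℂ] ℂ) r :=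
  ⟨0, 0, 0, 0, fun _ => rfl, by simp⟩

variable [FiniteDimensional ℂ V]

/-- A skew-symmetric form with trivial kernel lives on an even-dimensional space. -/
theorem even_finrank_of_skew_of_ker_eq_bot (K : V →ₗ[ℂ] V →ₗ[ℂ] ℂ)
    (hK : ∀ x y, K x y = -K y x) (hker : ∀ x, (∀ y, K x y = 0) → x = 0) :
    Even (finrank ℂ V) := by
  let b := finBasis ℂ V
  have hdet : (LinearMap.toMatrix₂ b b K).det ≠ 0 :=
    (LinearMap.separatingLeft_iff_det_ne_zero b).1 hker
  have hT : (LinearMap.toMatrix₂ b b K)ᵀ = -LinearMap.toMatrix₂ b b K := by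
    ext i j
    simp [LinearMap.toMatrix₂_apply, hK (b j) (b i)]
  have h := congrArg Matrix.det hT
  rw [Matrix.det_transpose, Matrix.det_neg, Fintype.card_fin] at h
  by_contra hodd
  rw [Nat.not_even_iff_odd] at hodd
  rw [hodd.neg_one_pow] at h
  apply hdet
  linear_combination h / 2

/-- If `E x` and `E.flip x` are nonzero multiples of `v` with `v x = 0`, then compressing `E` to
the kernel of `v` lowers the rank by at least two. -/
theorem finrank_range_compression_add_two_le (E E' : V →ₗ[ℂ] V →ₗ[ℂ] ℂ) (v : Dual ℂ V)
    (x z : V) (a b : ℂ) (ha : a ≠ 0) (hb : b ≠ 0) (hx : E x = a • v) (hx' : E.flip x = b • v)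
    (hvx : v x = 0) (hvz : v z = 1)
    (hE : ∀ y y', E' y y' = E (y - v y • z) (y' - v y' • z)) :
    finrank ℂ (LinearMap.range E') + 2 ≤ finrank ℂ (LinearMap.range E) := by
  let p : V →ₗ[ℂ] V := LinearMap.id - v.smulRight z
  have hp : ∀ y, p y = y - v y • z := fun y => by simp [p]
  let q : (V →ₗ[ℂ] ℂ) →ₗ[ℂ] (V →ₗ[ℂ] ℂ) := LinearMap.lcomp ℂ ℂ p
  let S := (LinearMap.ker v).map E
  have hvS : v ∈ S := ⟨a⁻¹ • x, by simp [hvx], by simp [hx, ha]⟩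
  have hv0 : v ≠ 0 := by
    rintro rfl
    simp at hvz
  have hSlt : finrank ℂ S < finrank ℂ (LinearMap.range E) := by
    apply Submodule.finrank_lt_finrank_of_lt
    refine lt_of_le_of_ne LinearMap.map_le_range fun h => ?_
    have hz : E z ∈ S := h ▸ LinearMap.mem_range_self E z
    obtain ⟨y, hy, hyz⟩ := hz
    have h1 : E y x = b * v y := by simpa using LinearMap.congr_fun hx' y
    have h2 : E z x = b * v z := by simpa using LinearMap.congr_fun hx' z
    rw [hyz, h2, hvz, show v y = 0 from hy] at h1
    simp [hb] at h1
  have hqlt : finrank ℂ (S.map q) < finrank ℂ S := by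
    have h := LinearMap.finrank_range_add_finrank_ker (q.domRestrict S)
    rw [LinearMap.range_domRestrict] at h
    have hpos : 0 < finrank ℂ (LinearMap.ker (q.domRestrict S)) := by
      refine Submodule.one_le_finrank_iff.2 ((Submodule.ne_bot_iff _).2 ⟨⟨v, hvS⟩, ?_, ?_⟩)
      · ext y
        simp [q, hp, hvz]
      · exact fun h => hv0 (congrArg Subtype.val h)
    omega
  have hle : LinearMap.range E' ≤ S.map q := by
    rintro _ ⟨y, rfl⟩
    refine ⟨E (p y), ⟨p y, by simp [hp, hvz], rfl⟩, ?_⟩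
    ext y'
    simp [q, hE, hp]
  have := Submodule.finrank_mono hle
  omega

/-- If `E x` and `E.flip x` are the same nonzero multiple `a • u` with `u x = 1`, then subtracting
`a • (u ⊗ u)` from `E` lowers the rank. -/
theorem finrank_range_sub_square_add_one_le (E E' : V →ₗ[ℂ] V →ₗ[ℂ] ℂ) (u : Dual ℂ V)
    (x : V) (a : ℂ) (ha : a ≠ 0) (hx : E x = a • u) (hx' : E.flip x = a • u)
    (hux : u x = 1) (hE : ∀ y y', E' y y' = E y y' - a * (u y * u y')) :
    finrank ℂ (LinearMap.range E') + 1 ≤ finrank ℂ (LinearMap.range E) := by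
  apply Submodule.finrank_lt_finrank_of_lt
  have hu : u = E (a⁻¹ • x) := by simp [hx, ha]
  refine lt_of_le_of_ne ?_ fun h => ?_
  · rintro _ ⟨y, rfl⟩
    refine ⟨y - (u y) • x, ?_⟩
    ext y'
    simp only [hE, hx, map_sub, map_smul, LinearMap.sub_apply, LinearMap.smul_apply, smul_eq_mul]
    ring
  · have hmem : u ∈ LinearMap.range E' := h ▸ ⟨_, hu.symm⟩
    obtain ⟨y, hy⟩ := hmem
    have h1 : E y x = a * u y := by simpa using LinearMap.congr_fun hx' y
    have h2 := hE y x
    rw [hy, h1, hux] at h2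
    simp at h2

/-- If every nonzero `x` with `A x` a multiple of `A.flip x` is anisotropic, then some `x` with
`A x = A.flip x` and `A x x = 1` spans the kernel of `A - A.flip`. -/
theorem exists_unique_symmetric_direction [Nontrivial V]
    (h : ∀ (x : V) (μ : ℂ), x ≠ 0 → A x = μ • A.flip x → A x x ≠ 0) :
    ∃ x, A x = A.flip x ∧ A x x = 1 ∧ ∀ y, A y = A.flip y → y = A x y • x := by
  have hinj : Function.Injective A := by
    rw [← LinearMap.ker_eq_bot, LinearMap.ker_eq_bot']
    intro x hx
    by_contra hne
    exact h x 0 hne (by simp [hx]) (by simp [hx])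
  have hsurj : Function.Surjective A :=
    (LinearMap.injective_iff_surjective_of_finrank_eq_finrank
      (Subspace.dual_finrank_eq (K := ℂ) (V := V)).symm).1 hinj
  have hinj' : Function.Injective A.flip := by
    rw [← LinearMap.ker_eq_bot, LinearMap.ker_eq_bot']
    intro x hx
    rw [← Module.forall_dual_apply_eq_zero_iff ℂ]
    intro f
    obtain ⟨y, rfl⟩ := hsurj f
    simpa using LinearMap.congr_fun hx y
  let e : V ≃ₗ[ℂ] Dual ℂ V := LinearEquiv.ofInjectiveOfFinrankEq A.flip hinj'
    (Subspace.dual_finrank_eq (K := ℂ) (V := V)).symm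
  have he : ∀ y, e y = A.flip y := fun y => rfl
  obtain ⟨μ, hμ⟩ := Module.End.exists_eigenvalue (e.symm.toLinearMap ∘ₗ A : V →ₗ[ℂ] V)
  obtain ⟨x, hx⟩ := hμ.exists_hasEigenvector
  have hAx : A x = μ • A.flip x := by
    have := congrArg e hx.apply_eq_smul
    rwa [LinearMap.comp_apply, LinearEquiv.coe_coe, e.apply_symm_apply, map_smul, he] at this
  have hxx := h x μ hx.2 hAx
  have hμ1 : μ = 1 := by
    have := LinearMap.congr_fun hAx x
    simp only [LinearMap.smul_apply, LinearMap.flip_apply, smul_eq_mul] at this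
    exact mul_right_cancel₀ hxx (by rw [one_mul]; exact this.symm)
  rw [hμ1, one_smul] at hAx
  obtain ⟨t, ht⟩ := IsAlgClosed.exists_pow_nat_eq (A x x) two_pos
  have ht0 : t ≠ 0 := by
    rintro rfl
    exact hxx (by simpa using ht.symm)
  have hnorm : A (t⁻¹ • x) (t⁻¹ • x) = 1 := by
    simp only [map_smul, LinearMap.smul_apply, smul_eq_mul, ← ht]
    field_simp
  have hsymm : A (t⁻¹ • x) = A.flip (t⁻¹ • x) := by rw [map_smul, map_smul, hAx]
  generalize t⁻¹ • x = x₀ at hnorm hsymm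
  refine ⟨x₀, hsymm, hnorm, fun y hy => ?_⟩
  -- If `y` were not a multiple of `x₀`, the plane they span would contain an isotropic vector.
  have hyx : A y x₀ = A x₀ y := by simpa using LinearMap.congr_fun hy x₀
  set w := y - A x₀ y • x₀ with hw
  have hwsymm : A w = A.flip w := by
    rw [hw, map_sub, map_sub, map_smul, map_smul, hy, hsymm]
  have hxw : A x₀ w = 0 := by simp [hw, hnorm]
  have hwx : A w x₀ = 0 := by simp [hw, hnorm, hyx]
  obtain ⟨s, hs⟩ := IsAlgClosed.exists_pow_nat_eq (-(A w w)) two_pos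
  have hzero : w + s • x₀ = 0 := by
    by_contra hne
    refine h _ 1 hne ?_ ?_
    · rw [one_smul, map_add, map_add, map_smul, map_smul, ← hwsymm, ← hsymm]
    · simp only [map_add, map_smul, LinearMap.add_apply, LinearMap.smul_apply, smul_eq_mul, hxw,
        hwx, hnorm]
      linear_combination hs
  have hs0 : s = 0 := by
    have := congrArg (A x₀) hzero
    simpa [hxw, hnorm] using this
  rw [hs0, zero_smul, add_zero] at hzero
  exact sub_eq_zero.1 hzero

/-- If `A - A.flip` has one-dimensional kernel, spanned by a vector `x` with `A x x = 1`, then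
the ambient dimension is odd. -/
theorem odd_finrank_of_unique_symmetric_direction (x : V) (hx : A x = A.flip x) (hxx : A x x = 1)
    (huniq : ∀ y, A y = A.flip y → y = A x y • x) : Odd (finrank ℂ V) := by
  have hK : Even (finrank ℂ (LinearMap.ker (A x))) := by
    refine even_finrank_of_skew_of_ker_eq_bot
      ((A - A.flip).compl₁₂ (LinearMap.ker (A x)).subtype (LinearMap.ker (A x)).subtype) ?_ ?_
    · intro y z
      simp
    · rintro ⟨y, hy⟩ h
      have hy0 : A x y = 0 := hy
      have hyx : A y x = A x y := (LinearMap.congr_fun hx y).symm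
      have : A y = A.flip y := by
        ext z
        have h1 := h ⟨z - A x z • x, by simp [hxx]⟩
        simp only [LinearMap.compl₁₂_apply, Submodule.subtype_apply, LinearMap.sub_apply,
          LinearMap.flip_apply, map_sub, map_smul, smul_eq_mul, hyx] at h1
        rw [LinearMap.flip_apply]
        linear_combination h1
      have hyu := huniq y this
      rw [hy0, zero_smul] at hyu
      exact Subtype.ext hyu
  have hr : LinearMap.range (A x) = ⊤ := by
    rw [LinearMap.range_eq_top]
    intro t
    exact ⟨t • x, by simp [hxx]⟩
  have hsum := LinearMap.finrank_range_add_finrank_ker (A x)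
  rw [hr, finrank_top, finrank_self] at hsum
  rw [← hsum, add_comm]
  exact hK.add_one

end

/-- A bilinear form whose pencil `A - λ A.flip` has rank at most `r` for almost every `λ` has an
`r`-decomposition. -/
theorem hasRankDecomposition_of_finrank_range_le (N : ℕ) :
    ∀ {V : Type} [AddCommGroup V] [Module ℂ V] [FiniteDimensional ℂ V]
      (A : V →ₗ[ℂ] V →ₗ[ℂ] ℂ) (r : ℕ), finrank ℂ V + r = N →
      (∀ᶠ t : ℂ in Filter.cofinite, finrank ℂ (LinearMap.range (A - t • A.flip)) ≤ r) →
      HasRankDecomposition A r := by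
  induction N using Nat.strong_induction_on with
  | _ N ih =>
  intro V _ _ _ A r hN hr
  obtain hV | hV := subsingleton_or_nontrivial V
  · have : A = 0 := Subsingleton.elim _ _
    exact this ▸ .zero
  by_cases hR : ∃ x ≠ 0, A x = 0 ∧ A.flip x = 0
  · obtain ⟨x, hx0, hx, hx'⟩ := hR
    obtain ⟨C, hC⟩ := Submodule.exists_isCompl (Submodule.span ℂ {x})
    let p : V →ₗ[ℂ] C := C.projectionOnto (Submodule.span ℂ {x}) hC.symm
    have hsub : ∀ y, ∃ a : ℂ, y = p y + a • x := by
      intro y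
      have hmem : y - p y ∈ Submodule.span ℂ {x} := by
        rw [← Submodule.projectionOnto_apply_eq_zero_iff hC.symm, map_sub,
          Submodule.projectionOnto_apply_left, sub_self]
      obtain ⟨a, ha⟩ := Submodule.mem_span_singleton.1 hmem
      exact ⟨a, by rw [ha, add_sub_cancel]⟩
    have hA : ∀ y y', A y y' = A.compl₁₂ C.subtype C.subtype (p y) (p y') := by
      intro y y'
      obtain ⟨a, ha⟩ := hsub y
      obtain ⟨a', ha'⟩ := hsub y'
      have h1 : ∀ z, A z x = 0 := fun z => LinearMap.congr_fun hx' z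
      conv_lhs => rw [ha, ha']
      simp [hx, h1]
    have hdim : finrank ℂ C < finrank ℂ V := by
      have := Submodule.finrank_add_eq_of_isCompl hC
      rw [finrank_span_singleton hx0] at this
      omega
    refine HasRankDecomposition.comp (ih (finrank ℂ C + r) (by omega) _ r rfl ?_) p hA
    filter_upwards [hr] with t ht
    refine le_trans ?_ ht
    have : A.compl₁₂ C.subtype C.subtype - t • (A.compl₁₂ C.subtype C.subtype).flip =
        C.subtype.dualMap ∘ₗ (A - t • A.flip) ∘ₗ C.subtype := by
      ext y y'
      simp
    rw [this, LinearMap.range_comp]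
    exact (Submodule.finrank_map_le _ _).trans
      (Submodule.finrank_mono (LinearMap.range_comp_le_range _ _))
  push Not at hR
  by_cases hiso : ∃ (x : V) (μ : ℂ), x ≠ 0 ∧ A x = μ • A.flip x ∧ A x x = 0
  · obtain ⟨x, μ, hx0, hx, hxx⟩ := hiso
    set v : Dual ℂ V := A.flip x with hv
    have hv0 : v ≠ 0 := fun h => hR x hx0 (by rw [hx, h, smul_zero]) h
    have hvx : v x = 0 := hxx
    obtain ⟨z, hz⟩ : ∃ z, v z = 1 := by
      obtain ⟨z, hz⟩ := DFunLike.ne_iff.1 hv0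
      exact ⟨(v z)⁻¹ • z, by simpa using inv_mul_cancel₀ hz⟩
    let p : V →ₗ[ℂ] V := LinearMap.id - v.smulRight z
    have hp : ∀ y, p y = y - v y • z := fun y => by simp [p]
    have hr' : ∀ᶠ t : ℂ in Filter.cofinite,
        finrank ℂ (LinearMap.range (A.compl₁₂ p p - t • (A.compl₁₂ p p).flip)) + 2 ≤ r := by
      have h1 : ∀ᶠ t : ℂ in Filter.cofinite, t ≠ μ := by
        simp
      have h2 : ∀ᶠ t : ℂ in Filter.cofinite, t ≠ μ⁻¹ := by
        simp
      filter_upwards [hr, h1, h2] with t ht ht1 ht2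
      refine le_trans (finrank_range_compression_add_two_le _ _ v x z (μ - t) (1 - t * μ)
        (sub_ne_zero.2 ht1.symm) ?_ ?_ ?_ hvx hz ?_) ht
      · intro h
        exact ht2 (eq_inv_of_mul_eq_one_left (sub_eq_zero.1 h).symm)
      · rw [LinearMap.sub_apply, LinearMap.smul_apply, hx, ← hv, sub_smul]
      · ext y
        have := LinearMap.congr_fun hx y
        simp only [LinearMap.smul_apply, smul_eq_mul] at this
        simp only [LinearMap.flip_apply, LinearMap.sub_apply, LinearMap.smul_apply, smul_eq_mul,
          this]
        rw [show A y x = v y from rfl]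
        ring
      · intro y y'
        simp only [LinearMap.compl₁₂_apply, LinearMap.sub_apply, LinearMap.smul_apply,
          LinearMap.flip_apply, hp]
    obtain ⟨t, ht⟩ := hr'.exists
    obtain ⟨k, rfl⟩ : ∃ k, r = k + 2 := ⟨r - 2, by omega⟩
    refine HasRankDecomposition.add_term (ih (finrank ℂ V + k) (by omega) (A.compl₁₂ p p) k rfl
      (hr'.mono fun t ht => by omega)) v (A z ∘ₗ p) (A.flip z) fun y y' => ?_
    simp only [LinearMap.compl₁₂_apply, hp, LinearMap.comp_apply, LinearMap.flip_apply, map_sub,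
      map_smul, LinearMap.sub_apply, LinearMap.smul_apply, smul_eq_mul]
    ring
  push Not at hiso
  obtain ⟨x, hx, hxx, huniq⟩ := exists_unique_symmetric_direction hiso
  have hodd := odd_finrank_of_unique_symmetric_direction x hx hxx huniq
  have hne1 : ∀ᶠ t : ℂ in Filter.cofinite, t ≠ 1 := by
    simp
  have hdim : finrank ℂ V ≤ r := by
    obtain ⟨t, ht, ht1⟩ := (hr.and hne1).exists
    rw [LinearMap.finrank_range_of_inj] at ht
    · exact ht
    · rw [← LinearMap.ker_eq_bot, LinearMap.ker_eq_bot']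
      intro y hy
      by_contra hy0
      have hy' : A y = t • A.flip y := sub_eq_zero.1 hy
      have hyy := hiso y t hy0 hy'
      have := LinearMap.congr_fun hy' y
      simp only [LinearMap.smul_apply, LinearMap.flip_apply, smul_eq_mul] at this
      exact ht1 (mul_right_cancel₀ hyy (by rw [one_mul]; exact this.symm))
  set u : Dual ℂ V := A x with hu
  let A' : V →ₗ[ℂ] V →ₗ[ℂ] ℂ := A - u.smulRight u
  have hA' : ∀ y y', A' y y' = A y y' - u y * u y' := fun y y' => by simp [A']
  have hr' : ∀ᶠ t : ℂ in Filter.cofinite,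
      finrank ℂ (LinearMap.range (A' - t • A'.flip)) + 1 ≤
        finrank ℂ (LinearMap.range (A - t • A.flip)) := by
    filter_upwards [hne1] with t ht1
    refine finrank_range_sub_square_add_one_le _ _ u x (1 - t) (sub_ne_zero.2 ht1.symm) ?_ ?_
      hxx ?_
    · rw [LinearMap.sub_apply, LinearMap.smul_apply, ← hx, ← hu, sub_smul, one_smul]
    · ext y
      have : A y x = u y := (LinearMap.congr_fun hx y).symm
      simp only [LinearMap.flip_apply, LinearMap.sub_apply, LinearMap.smul_apply, smul_eq_mul,
        this, ← hu]
      ring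
    · intro y y'
      simp only [LinearMap.sub_apply, LinearMap.smul_apply, LinearMap.flip_apply, smul_eq_mul, hA']
      ring
  obtain ⟨m, hm⟩ := hodd
  obtain ⟨k, rfl | rfl⟩ := Nat.even_or_odd' r
  · obtain ⟨l, rfl⟩ : ∃ l, k = l + 1 := ⟨k - 1, by omega⟩
    refine HasRankDecomposition.add_term (ih (finrank ℂ V + 2 * l) (by omega) A' (2 * l) rfl ?_)
      u u 0 fun y y' => by simp [hA']
    filter_upwards [hr'] with t ht
    have := LinearMap.finrank_range_le (A - t • A.flip)
    omega
  · refine HasRankDecomposition.add_square (ih (finrank ℂ V + 2 * k) (by omega) A' (2 * k) rfl ?_)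
      (even_two_mul k) u fun y y' => by simp [hA']
    filter_upwards [hr', hr] with t ht ht'
    omega

/-- **Rank-1 decomposition for ⊤-anti-palindromic pencils.**
If `E(λ) = A + λB` is an `n × n` ⊤-anti-palindromic matrix pencil (`Aᵀ = -B`) of rank
`r ≤ n`, and `s = ⌊r/2⌋`, then there exist vectors `v_j ∈ ℂ^n`, vector pencils
`w_j(λ) = c_j + λ d_j` of degree at most one (so `rev w_j(λ) = d_j + λ c_j`), and
(if `r` is odd) a vector `u ∈ ℂ^n`, such that
`A + λB = Σ (v_j w_j(λ)ᵀ − (rev w_j)(λ) v_jᵀ)` if `r` is even, and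
`A + λB = (1−λ) u uᵀ + Σ (v_j w_j(λ)ᵀ − (rev w_j)(λ) v_jᵀ)` if `r` is odd. -/
theorem top_anti_palindromic_rank_one_decomposition
    (n r : ℕ) (hrn : r ≤ n) (A B : Matrix (Fin n) (Fin n) ℂ)
    (hAB : Aᵀ = -B)
    (hrank : PencilRankEq n A B r) :
    ∃ (v c d : Fin (r / 2) → Fin n → ℂ) (u : Fin n → ℂ),
      (Even r → ∀ lam : ℂ,
        A + lam • B =
          ∑ j : Fin (r / 2),
            (vecMulVec (v j) (c j + lam • d j)
              - vecMulVec (d j + lam • c j) (v j))) ∧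
      (Odd r → ∀ lam : ℂ,
        A + lam • B =
          ((1 : ℂ) - lam) • vecMulVec u u +
          ∑ j : Fin (r / 2),
            (vecMulVec (v j) (c j + lam • d j)
              - vecMulVec (d j + lam • c j) (v j))) := by
  have hB : B = -Aᵀ := by rw [hAB, neg_neg]
  subst hB
  obtain ⟨v, c, d, u, hu, h⟩ := hasRankDecomposition_of_finrank_range_le _
    (Matrix.toLinearMap₂' ℂ A) r rfl (Filter.Eventually.of_forall fun t => by
      refine le_trans ?_ (hrank.2 t)
      have : Matrix.toLinearMap₂' ℂ A - t • (Matrix.toLinearMap₂' ℂ A).flip =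
          (dotProductBilin ℂ ℂ) ∘ₗ (A + t • -Aᵀ)ᵀ.mulVecLin := by
        ext i j
        simp [Matrix.toLinearMap₂'_apply', dotProductBilin, sub_eq_add_neg]
      rw [this, LinearMap.range_comp]
      refine (Submodule.finrank_map_le _ _).trans ?_
      rw [← Matrix.rank_transpose]
      exact le_rfl)
  let co : Dual ℂ (Fin n → ℂ) → Fin n → ℂ := fun f i => f (Pi.single i 1)
  have hA : A = vecMulVec (co u) (co u) +
      ∑ j, (vecMulVec (co (v j)) (co (c j)) + vecMulVec (co (d j)) (co (v j))) := by
    ext i j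
    have := h (Pi.single i 1) (Pi.single j 1)
    simpa [Matrix.toLinearMap₂'_apply', Matrix.sum_apply, vecMulVec_apply, co] using this
  have key : ∀ lam : ℂ, A + lam • -Aᵀ = ((1 : ℂ) - lam) • vecMulVec (co u) (co u) +
      ∑ j, (vecMulVec (co (v j)) (co (c j) + lam • -co (d j))
        - vecMulVec (-co (d j) + lam • co (c j)) (co (v j))) := by
    intro lam
    ext i k
    have h1 := congrFun (congrFun hA i) k
    have h2 := congrFun (congrFun hA k) i
    simp only [Matrix.add_apply, Matrix.sum_apply, vecMulVec_apply] at h1 h2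
    simp only [Matrix.add_apply, Matrix.smul_apply, Matrix.neg_apply, Matrix.transpose_apply,
      Matrix.sum_apply, Matrix.sub_apply, vecMulVec_apply, Pi.add_apply, Pi.smul_apply,
      Pi.neg_apply, smul_eq_mul, h1, h2]
    rw [mul_neg, mul_add, neg_add, Finset.mul_sum, ← Finset.sum_neg_distrib]
    have hsum : ∀ a b c e : ℂ, a + b + (c + e) = (a + c) + (b + e) := fun _ _ _ _ => by ring
    rw [hsum, ← Finset.sum_add_distrib]
    congr 1
    · ring
    · exact Finset.sum_congr rfl fun j _ => by ring
  refine ⟨fun j => co (v j), fun j => co (c j), fun j => -co (d j), co u, fun hr lam => ?_,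
    fun _ lam => key lam⟩
  have hu0 : co u = 0 := by
    rw [hu hr]
    rfl
  rw [key lam, hu0, zero_vecMulVec, smul_zero, zero_add]
end
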